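/- arXiv:1801.06758 — 2 statements merged into one kernel-verified Lean document; each statement's English description precedes it below -/
import Mathlib

section
/- Every simple graph with maximum degree at most 4 is strongly 22-edge-choosable; that is, for every assignment L of a set (list) of at least 22 colors to each edge, there exists a strong edge-coloring c of G with c(e) ∈ L(e) for every edge e. -/
/-- Two edges are "close" (distance at most 1): some endpoint of one equals,
or is adjacent to, some endpoint of the other. In a strong edge-coloring,
distinct close edges must get distinct colors. -/
def EdgeClose {V : Type*} (G : SimpleGraph V) (e₁ e₂ : Sym2 V) : Prop :=
  ∃ u w, u ∈ e₁ ∧ w ∈ e₂ ∧ (u = w ∨ G.Adj u w)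

/-- `c` is a strong edge-coloring of `G` (viewed as a function on all of `Sym2 V`,
only its values on edges of `G` matter). -/
def IsStrongEdgeColoringOn {V : Type*} (G : SimpleGraph V) (c : Sym2 V → ℕ) : Prop :=
  ∀ e₁ ∈ G.edgeSet, ∀ e₂ ∈ G.edgeSet, e₁ ≠ e₂ → EdgeClose G e₁ e₂ → c e₁ ≠ c e₂

/-- `G` is strongly `L`-edge-colorable. -/
def StronglyLColorable {V : Type*} (G : SimpleGraph V) (L : Sym2 V → Finset ℕ) : Prop :=
  ∃ c : Sym2 V → ℕ, IsStrongEdgeColoringOn G c ∧ ∀ e ∈ G.edgeSet, c e ∈ L e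

/-- `G` is strongly `k`-edge-choosable. -/
def StronglyEdgeChoosable {V : Type*} (G : SimpleGraph V) (k : ℕ) : Prop :=
  ∀ L : Sym2 V → Finset ℕ, (∀ e ∈ G.edgeSet, k ≤ (L e).card) → StronglyLColorable G L

namespace SEC
open Finset

def Good {α : Type*} (D : SimpleGraph α) (R : Finset α) (L : α → Finset ℕ)
    (M : Fin 4 → Finset ℕ) : Prop :=
  ∃ (c : α → ℕ) (k : Fin 4 → ℕ), (∀ f ∈ R, c f ∈ L f) ∧
    (∀ f ∈ R, ∀ g ∈ R, D.Adj f g → c f ≠ c g) ∧ (∀ i, k i ∈ M i) ∧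
    Function.Injective k ∧ ∀ i, ∀ f ∈ R, k i ≠ c f

lemma hall_max {ι : Type*} [DecidableEq ι] (A : Finset ι) (L : ι → Finset ℕ) :
    ∃ S ⊆ A, (S = ∅ ∨ #(S.biUnion L) < #S) ∧ ∃ c : ι → ℕ,
      (∀ a ∈ A \ S, c a ∈ L a ∧ c a ∉ S.biUnion L) ∧
      (∀ a ∈ A \ S, ∀ b ∈ A \ S, a ≠ b → c a ≠ c b) := by
  have key : ∃ S ⊆ A, (S = ∅ ∨ #(S.biUnion L) < #S) ∧
      ∀ T ⊆ A, #T + #(S.biUnion L) ≤ #S + #(T.biUnion L) := by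
    obtain ⟨S, hS, hmax⟩ := exists_max_image A.powerset
      (fun S => (#S : ℤ) - #(S.biUnion L)) ⟨∅, by simp⟩
    rw [mem_powerset] at hS
    by_cases h : #(S.biUnion L) < #S
    · refine ⟨S, hS, Or.inr h, fun T hT => ?_⟩
      have := hmax T (mem_powerset.2 hT)
      omega
    · refine ⟨∅, by simp, Or.inl rfl, fun T hT => ?_⟩
      have := hmax T (mem_powerset.2 hT)
      simp
      omega
  obtain ⟨S, hSA, hS, hmax⟩ := key
  refine ⟨S, hSA, hS, ?_⟩
  have hall := (Finset.all_card_le_biUnion_card_iff_exists_injective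
    (fun x : {x // x ∈ A \ S} => L x.1 \ S.biUnion L)).1 ?_
  · obtain ⟨f, hf, hfm⟩ := hall
    refine ⟨fun a => if h : a ∈ A \ S then f ⟨a, h⟩ else 0, ?_, ?_⟩
    · intro a ha
      have := hfm ⟨a, ha⟩
      simp only [dif_pos ha]
      rwa [mem_sdiff] at this
    · intro a ha b hb hab
      simp only [dif_pos ha, dif_pos hb]
      intro h
      exact hab (congrArg Subtype.val (hf h))
  · intro s
    set T := s.map (Function.Embedding.subtype _) with hT
    have hTc : #T = #s := card_map _
    have hTA : ∀ x ∈ T, x ∈ A \ S := by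
      intro x hx
      simp only [hT, mem_map, Function.Embedding.coe_subtype] at hx
      obtain ⟨y, _, rfl⟩ := hx
      exact y.2
    have hdis : Disjoint T S := by
      rw [disjoint_left]
      intro x hx hxS
      exact (mem_sdiff.1 (hTA x hx)).2 hxS
    have h1 := hmax (T ∪ S) (union_subset (fun x hx => (mem_sdiff.1 (hTA x hx)).1) hSA)
    rw [card_union_of_disjoint hdis] at h1
    have h2 : (T ∪ S).biUnion L ⊆
        (s.biUnion fun x => L x.1 \ S.biUnion L) ∪ S.biUnion L := by
      intro c hc
      by_cases hcS : c ∈ S.biUnion L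
      · exact mem_union_right _ hcS
      · apply mem_union_left
        obtain ⟨x, hx, hcx⟩ := mem_biUnion.1 hc
        rcases mem_union.1 hx with hx | hx
        · simp only [hT, mem_map, Function.Embedding.coe_subtype] at hx
          obtain ⟨y, hy, rfl⟩ := hx
          exact mem_biUnion.2 ⟨y, hy, mem_sdiff.2 ⟨hcx, hcS⟩⟩
        · exact absurd (mem_biUnion.2 ⟨x, hx, hcx⟩) hcS
    have h3 := (card_le_card h2).trans (card_union_le _ _)
    omega

lemma greedy {α : Type*} (D : SimpleGraph α) [DecidableEq α] [DecidableRel D.Adj]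
    (L : α → Finset ℕ) (R : Finset α)
    (h : ∀ f ∈ R, #{g ∈ R | D.Adj f g} < #(L f)) :
    ∃ c : α → ℕ, (∀ f ∈ R, c f ∈ L f) ∧ (∀ f ∈ R, ∀ g ∈ R, D.Adj f g → c f ≠ c g) := by
  induction R using Finset.induction_on with
  | empty => exact ⟨fun _ => 0, by simp, by simp⟩
  | insert a R ha ih =>
    obtain ⟨c, hc1, hc2⟩ := ih (fun f hf => lt_of_le_of_lt
      (card_le_card (filter_subset_filter _ (subset_insert _ _))) (h f (mem_insert_of_mem hf)))
    have h1 : #(({g ∈ R | D.Adj a g}).image c) < #(L a) :=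
      lt_of_le_of_lt (card_image_le.trans
        (card_le_card (filter_subset_filter _ (subset_insert _ _)))) (h a (mem_insert_self _ _))
    obtain ⟨x, hx, hxn⟩ := exists_mem_notMem_of_card_lt_card h1
    have hx' : ∀ g ∈ R, D.Adj a g → x ≠ c g := by
      intro g hg hag he
      exact hxn (mem_image.2 ⟨g, mem_filter.2 ⟨hg, hag⟩, he.symm⟩)
    have hne : ∀ g ∈ R, g ≠ a := fun g hg he => ha (he ▸ hg)
    refine ⟨Function.update c a x, ?_, ?_⟩
    · intro f hf
      rcases mem_insert.1 hf with rfl | hf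
      · simpa
      · simpa [Function.update_of_ne (hne f hf)] using hc1 f hf
    · intro f hf g hg hfg
      rcases mem_insert.1 hf with hf' | hf' <;> rcases mem_insert.1 hg with hg' | hg'
      · rw [hf', hg'] at hfg
        exact absurd hfg (D.irrefl)
      · subst hf'
        simpa [Function.update_of_ne (hne g hg')] using hx' g hg' hfg
      · subst hg'
        simpa [Function.update_of_ne (hne f hf')] using (hx' f hf' hfg.symm).symm
      · simpa [Function.update_of_ne (hne f hf'), Function.update_of_ne (hne g hg')]
          using hc2 f hf' g hg' hfg

/-- If the gadget is not colorable, there is a deficient set meeting the clique. -/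
lemma obstruct {α : Type*} (D : SimpleGraph α) [DecidableEq α] [DecidableRel D.Adj]
    (L : α → Finset ℕ) (M : Fin 4 → Finset ℕ) (R : Finset α) (q : ℕ)
    (h : ∀ f ∈ R, #{g ∈ R | D.Adj f g} < #(L f)) (hM : ∀ i, q ≤ #(M i))
    (hng : ¬ Good D R L M) :
    ∃ T ⊆ R, ∃ U : Finset ℕ, q ≤ #U ∧ #U ≤ #T + 3 ∧ ∀ f ∈ T, L f ⊆ U := by
  obtain ⟨S, hSA, hS, c, hc1, hc2⟩ := hall_max (R.disjSum (univ : Finset (Fin 4))) (Sum.elim L M)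
  by_cases hK : ∃ i : Fin 4, Sum.inr i ∈ S
  · obtain ⟨i, hi⟩ := hK
    refine ⟨S.toLeft, ?_, S.biUnion (Sum.elim L M), ?_, ?_, ?_⟩
    · intro x hx
      have := hSA (mem_toLeft.1 hx)
      simpa using this
    · refine (hM i).trans (card_le_card ?_)
      exact subset_biUnion_of_mem (Sum.elim L M) hi
    · rcases hS with rfl | hS
      · simp at hi
      · have h1 : #S.toLeft + #S.toRight = #S := card_toLeft_add_card_toRight
        have h2 : #S.toRight ≤ 4 := by simpa using card_le_univ S.toRight
        omega
    · intro f hf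
      exact subset_biUnion_of_mem (Sum.elim L M) (mem_toLeft.1 hf)
  · exfalso
    push Not at hK
    apply hng
    obtain ⟨c0, h01, h02⟩ := greedy D L S.toLeft (by
      have hsub : S.toLeft ⊆ R := by
        intro x hx
        have := hSA (mem_toLeft.1 hx)
        simpa using this
      intro f hf
      exact lt_of_le_of_lt (card_le_card (filter_subset_filter _ hsub)) (h f (hsub hf)))
    have hin : ∀ f ∈ S.toLeft, c0 f ∈ S.biUnion (Sum.elim L M) := fun f hf =>
      mem_biUnion.2 ⟨Sum.inl f, mem_toLeft.1 hf, h01 f hf⟩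
    have hout : ∀ f ∈ R, f ∉ S.toLeft → Sum.inl f ∈ R.disjSum (univ : Finset (Fin 4)) \ S := by
      intro f hf hn
      rw [mem_toLeft] at hn
      simp [hf, hn]
    have houtK : ∀ i : Fin 4, Sum.inr i ∈ R.disjSum (univ : Finset (Fin 4)) \ S := by
      intro i
      simp [hK i]
    refine ⟨fun f => if f ∈ S.toLeft then c0 f else c (Sum.inl f), fun i => c (Sum.inr i),
      ?_, ?_, ?_, ?_, ?_⟩
    · intro f hf
      by_cases hfS : f ∈ S.toLeft
      · simpa only [if_pos hfS] using h01 f hfS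
      · simp only [if_neg hfS]
        exact (hc1 _ (hout f hf hfS)).1
    · intro f hf g hg hfg
      by_cases hfS : f ∈ S.toLeft <;> by_cases hgS : g ∈ S.toLeft
      · simpa only [if_pos hfS, if_pos hgS] using h02 f hfS g hgS hfg
      · simp only [if_pos hfS, if_neg hgS]
        intro he
        exact (hc1 _ (hout g hg hgS)).2 (he ▸ hin f hfS)
      · simp only [if_pos hgS, if_neg hfS]
        intro he
        exact (hc1 _ (hout f hf hfS)).2 (he ▸ hin g hgS)
      · simp only [if_neg hgS, if_neg hfS]
        exact hc2 _ (hout f hf hfS) _ (hout g hg hgS) (by simpa using hfg.ne)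
    · intro i
      exact (hc1 _ (houtK i)).1
    · intro i j hij
      by_contra hne
      exact hc2 _ (houtK i) _ (houtK j) (by simpa using hne) hij
    · intro i f hf
      by_cases hfS : f ∈ S.toLeft
      · simp only [if_pos hfS]
        intro he
        exact (hc1 _ (houtK i)).2 (he ▸ hin f hfS)
      · simp only [if_neg hfS]
        exact hc2 _ (houtK i) _ (hout f hf hfS) (by simp)

lemma hallGood {α : Type*} (D : SimpleGraph α) [DecidableEq α]
    (L : α → Finset ℕ) (M : Fin 4 → Finset ℕ) (R : Finset α)
    (h : ∀ S ⊆ R.disjSum (univ : Finset (Fin 4)), #S ≤ #(S.biUnion (Sum.elim L M))) :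
    Good D R L M := by
  obtain ⟨S, hSA, hS, c, hc1, hc2⟩ := hall_max (R.disjSum (univ : Finset (Fin 4))) (Sum.elim L M)
  rcases hS with rfl | hS
  · rw [sdiff_empty] at hc1 hc2
    have hl : ∀ f ∈ R, Sum.inl f ∈ R.disjSum (univ : Finset (Fin 4)) := by simp
    have hr : ∀ i, Sum.inr i ∈ R.disjSum (univ : Finset (Fin 4)) := by simp
    refine ⟨fun f => c (Sum.inl f), fun i => c (Sum.inr i), fun f hf => (hc1 _ (hl f hf)).1,
      fun f hf g hg hfg => hc2 _ (hl f hf) _ (hl g hg) (by simpa using hfg.ne),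
      fun i => (hc1 _ (hr i)).1, ?_, fun i f hf => hc2 _ (hr i) _ (hl f hf) (by simp)⟩
    intro i j hij
    by_contra hne
    exact hc2 _ (hr i) _ (hr j) (by simpa using hne) hij
  · exact absurd (h S hSA) (by omega)

/-- lists after giving the color `γ` to `f` and `g` -/
def Lnew {α : Type*} (D : SimpleGraph α) [DecidableRel D.Adj] (L : α → Finset ℕ)
    (f g : α) (γ : ℕ) : α → Finset ℕ :=
  fun h => if D.Adj h f ∨ D.Adj h g then (L h).erase γ else L h

lemma pairStep {α : Type*} (D : SimpleGraph α) [DecidableEq α] [DecidableRel D.Adj]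
    (L : α → Finset ℕ) (M : Fin 4 → Finset ℕ) (R : Finset α) (f g : α) (γ : ℕ)
    (hfg : ¬ D.Adj f g) (hf : γ ∈ L f) (hg : γ ∈ L g)
    (h : Good D ((R.erase f).erase g) (Lnew D L f g γ) (fun i => (M i).erase γ)) :
    Good D R L M := by
  obtain ⟨c, k, h1, h2, h3, h4, h5⟩ := h
  have hmem : ∀ x ∈ R, x ≠ f → x ≠ g → x ∈ (R.erase f).erase g := by
    intro x hx h1 h2; simp [*]
  have hL : ∀ x ∈ R, x ≠ f → x ≠ g → c x ∈ L x := by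
    intro x hx hxf hxg
    have := h1 x (hmem x hx hxf hxg)
    unfold Lnew at this
    split_ifs at this
    · exact mem_of_mem_erase this
    · exact this
  have hL2 : ∀ x ∈ R, x ≠ f → x ≠ g → (D.Adj x f ∨ D.Adj x g) → c x ≠ γ := by
    intro x hx hxf hxg ha
    have := h1 x (hmem x hx hxf hxg)
    unfold Lnew at this
    rw [if_pos ha] at this
    exact ne_of_mem_erase this
  refine ⟨fun x => if x = f ∨ x = g then γ else c x, k, ?_, ?_, fun i => mem_of_mem_erase (h3 i),
    h4, ?_⟩
  · intro x hx
    by_cases hh : x = f ∨ x = g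
    · simp only [if_pos hh]
      rcases hh with rfl | rfl <;> assumption
    · simp only [if_neg hh]
      push Not at hh
      exact hL x hx hh.1 hh.2
  · intro x hx y hy hxy
    by_cases hh : x = f ∨ x = g <;> by_cases hh' : y = f ∨ y = g
    · exfalso
      rcases hh with rfl | rfl <;> rcases hh' with rfl | rfl
      · exact D.irrefl hxy
      · exact hfg hxy
      · exact hfg hxy.symm
      · exact D.irrefl hxy
    · simp only [if_pos hh, if_neg hh']
      push Not at hh'
      refine (hL2 y hy hh'.1 hh'.2 ?_).symm
      rcases hh with rfl | rfl
      · exact Or.inl hxy.symm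
      · exact Or.inr hxy.symm
    · simp only [if_pos hh', if_neg hh]
      push Not at hh
      refine (hL2 x hx hh.1 hh.2 ?_)
      rcases hh' with rfl | rfl
      · exact Or.inl hxy
      · exact Or.inr hxy
    · simp only [if_neg hh', if_neg hh]
      push Not at hh hh'
      exact h2 x (hmem x hx hh.1 hh.2) y (hmem y hy hh'.1 hh'.2) hxy
  · intro i x hx
    by_cases hh : x = f ∨ x = g
    · simp only [if_pos hh]
      exact ne_of_mem_erase (h3 i)
    · simp only [if_neg hh]
      push Not at hh
      exact h5 i x (hmem x hx hh.1 hh.2)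

lemma Lnew_card {α : Type*} (D : SimpleGraph α) [DecidableRel D.Adj] (L : α → Finset ℕ)
    (f g : α) (γ : ℕ) (h : α) : #(L h) ≤ #(Lnew D L f g γ h) + 1 := by
  unfold Lnew
  split_ifs
  · have := pred_card_le_card_erase (s := L h) (a := γ)
    omega
  · omega

lemma erase_card (s : Finset ℕ) (γ : ℕ) : #s ≤ #(s.erase γ) + 1 := by
  have := pred_card_le_card_erase (s := s) (a := γ)
  omega

end SEC

namespace SEC
open Finset

lemma hallGood' {α : Type*} (D : SimpleGraph α) [DecidableEq α]
    (L : α → Finset ℕ) (M : Fin 4 → Finset ℕ) (R : Finset α) (q : ℕ) (hM : ∀ i, q ≤ #(M i))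
    (h : ∀ T ⊆ R, ∀ U : Finset ℕ, (∀ f ∈ T, L f ⊆ U) → ∀ k ≤ 4, (0 < k → q ≤ #U) →
      #T + k ≤ #U) : Good D R L M := by
  apply hallGood
  intro S hSA
  have h1 : #S.toLeft + #S.toRight = #S := card_toLeft_add_card_toRight
  have h2 : #S.toRight ≤ 4 := by simpa using card_le_univ S.toRight
  rw [← h1]
  refine h _ ?_ _ ?_ _ h2 ?_
  · intro x hx
    have := hSA (mem_toLeft.1 hx)
    simpa using this
  · intro f hf
    exact subset_biUnion_of_mem (Sum.elim L M) (mem_toLeft.1 hf)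
  · intro hk
    obtain ⟨i, hi⟩ := card_pos.1 hk
    refine (hM i).trans (card_le_card ?_)
    exact subset_biUnion_of_mem (Sum.elim L M) (mem_toRight.1 hi)

lemma hallSimple {α : Type*} (D : SimpleGraph α) [DecidableEq α]
    (L : α → Finset ℕ) (M : Fin 4 → Finset ℕ) (R : Finset α) (hM : ∀ i, #R + 4 ≤ #(M i))
    (hL : ∀ f ∈ R, #R ≤ #(L f)) : Good D R L M := by
  apply hallGood' D L M R _ hM
  intro T hT U hU k hk hkU
  have hc := card_le_card hT
  rcases Nat.eq_zero_or_pos k with rfl | hk0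
  · rcases T.eq_empty_or_nonempty with rfl | ⟨f, hf⟩
    · simp
    · have := hL f (hT hf)
      have := card_le_card (hU f hf)
      omega
  · have := hkU hk0
    omega

lemma hallPair {α : Type*} (D : SimpleGraph α) [DecidableEq α]
    (L : α → Finset ℕ) (M : Fin 4 → Finset ℕ) (R : Finset α) (hM : ∀ i, #R + 3 ≤ #(M i))
    (hL : ∀ f ∈ R, #R ≤ #(L f) + 1) (p q : α) (hp : p ∈ R) (hq : q ∈ R)
    (hd : Disjoint (L p) (L q)) (hs : #R + 4 ≤ #(L p) + #(L q)) : Good D R L M := by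
  apply hallGood' D L M R _ hM
  intro T hT U hU k hk hkU
  have hc := card_le_card hT
  by_cases hpq : p ∈ T ∧ q ∈ T
  · have := card_le_card (union_subset (hU p hpq.1) (hU q hpq.2))
    rw [card_union_of_disjoint hd] at this
    omega
  · have hlt : #T < #R := by
      apply card_lt_card
      refine ⟨hT, fun h => hpq ⟨h hp, h hq⟩⟩
    rcases Nat.eq_zero_or_pos k with rfl | hk0
    · rcases T.eq_empty_or_nonempty with rfl | ⟨f, hf⟩
      · simp
      · have := hL f (hT hf)
        have := card_le_card (hU f hf)
        omega
    · have := hkU hk0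
      omega

lemma card_erase2 {α : Type*} [DecidableEq α] (R : Finset α) (p q : α) (hp : p ∈ R) (hq : q ∈ R)
    (hpq : p ≠ q) : #((R.erase p).erase q) + 2 = #R := by
  have h1 := card_erase_add_one hp
  have h2 := card_erase_add_one (mem_erase.2 ⟨hpq.symm, hq⟩)
  omega

lemma c4_zero {α : Type*} (D : SimpleGraph α) [DecidableEq α]
    (L : α → Finset ℕ) (M : Fin 4 → Finset ℕ) (R : Finset α) (hR : #R = 8)
    (hM : ∀ i, 12 ≤ #(M i)) (hL : ∀ f ∈ R, 7 ≤ #(L f)) (p : α) (hp : p ∈ R) (hLp : 8 ≤ #(L p)) :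
    Good D R L M := by
  apply hallGood' D L M R _ hM
  intro T hT U hU k hk hkU
  have hc := card_le_card hT
  rcases Nat.eq_zero_or_pos k with rfl | hk0
  · by_cases hpT : p ∈ T
    · have := card_le_card (hU p hpT)
      omega
    have hlt : #T < #R := by
      apply card_lt_card
      refine ⟨hT, fun h => hpT (h hp)⟩
    rcases T.eq_empty_or_nonempty with rfl | ⟨f, hf⟩
    · simp
    · have := hL f (hT hf)
      have := card_le_card (hU f hf)
      omega
  · have := hkU hk0
    omega

lemma c4_one {α : Type*} (D : SimpleGraph α) [DecidableEq α]
    (L : α → Finset ℕ) (M : Fin 4 → Finset ℕ) (R : Finset α) (hR : #R = 8)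
    (hM : ∀ i, 11 ≤ #(M i)) (hL : ∀ f ∈ R, 7 ≤ #(L f)) (p q : α) (hp : p ∈ R) (hq : q ∈ R)
    (hpq : p ≠ q) (hn : ¬ D.Adj p q) : Good D R L M := by
  classical
  by_cases hd : Disjoint (L p) (L q)
  · have := hL p hp
    have := hL q hq
    exact hallPair D L M R (by rw [hR]; exact hM) (by rw [hR]; intro f hf; have := hL f hf; omega)
      p q hp hq hd (by omega)
  · obtain ⟨γ, h1, h2⟩ := not_disjoint_iff.1 hd
    have hc := card_erase2 R p q hp hq hpq
    refine pairStep D L M R p q γ hn h1 h2 (hallSimple _ _ _ _ ?_ ?_)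
    · intro i
      have := erase_card (M i) γ
      have := hM i
      omega
    · intro f hf
      have := Lnew_card D L p q γ f
      have := hL f (mem_of_mem_erase (mem_of_mem_erase hf))
      omega

lemma c4_six {α : Type*} (D : SimpleGraph α) [DecidableEq α]
    (L : α → Finset ℕ) (M : Fin 4 → Finset ℕ) (R : Finset α) (hR : #R = 6)
    (hM : ∀ i, 9 ≤ #(M i)) (hL : ∀ f ∈ R, 6 ≤ #(L f)) (p q : α) (hp : p ∈ R) (hq : q ∈ R)
    (hpq : p ≠ q) (hn : ¬ D.Adj p q) : Good D R L M := by
  classical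
  by_cases hd : Disjoint (L p) (L q)
  · have := hL p hp
    have := hL q hq
    exact hallPair D L M R (by rw [hR]; exact hM) (by rw [hR]; intro f hf; have := hL f hf; omega)
      p q hp hq hd (by omega)
  · obtain ⟨γ, h1, h2⟩ := not_disjoint_iff.1 hd
    have hc := card_erase2 R p q hp hq hpq
    refine pairStep D L M R p q γ hn h1 h2 (hallSimple _ _ _ _ ?_ ?_)
    · intro i
      have := erase_card (M i) γ
      have := hM i
      omega
    · intro f hf
      have := Lnew_card D L p q γ f
      have := hL f (mem_of_mem_erase (mem_of_mem_erase hf))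
      omega

lemma c4_two {α : Type*} (D : SimpleGraph α) [DecidableEq α]
    (L : α → Finset ℕ) (M : Fin 4 → Finset ℕ) (R : Finset α) (hR : #R = 8)
    (hM : ∀ i, 10 ≤ #(M i)) (hL : ∀ f ∈ R, 7 ≤ #(L f)) (p q p' q' : α) (hp : p ∈ R) (hq : q ∈ R)
    (hp' : p' ∈ R) (hq' : q' ∈ R)
    (hpq : p ≠ q) (hn : ¬ D.Adj p q) (hpq' : p' ≠ q') (hn' : ¬ D.Adj p' q')
    (h1 : p ≠ p') (h2 : p ≠ q') (h3 : q ≠ p') (h4 : q ≠ q') : Good D R L M := by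
  classical
  have main : ∀ p q p' q' : α, p ∈ R → q ∈ R → p' ∈ R → q' ∈ R → p ≠ q → ¬ D.Adj p q → p' ≠ q' →
      ¬ D.Adj p' q' → p ≠ p' → p ≠ q' → q ≠ p' → q ≠ q' → ¬ Disjoint (L p) (L q) →
      Good D R L M := by
    intro p q p' q' hp hq hp' hq' hpq hn hpq' hn' h1 h2 h3 h4 hd
    obtain ⟨γ, e1, e2⟩ := not_disjoint_iff.1 hd
    have hc := card_erase2 R p q hp hq hpq
    refine pairStep D L M R p q γ hn e1 e2
      (c4_six _ _ _ _ (by omega) ?_ ?_ p' q' (by simp [*, Ne.symm]) (by simp [*, Ne.symm]) hpq' hn')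
    · intro i
      have := erase_card (M i) γ
      have := hM i
      omega
    · intro f hf
      have := Lnew_card D L p q γ f
      have := hL f (mem_of_mem_erase (mem_of_mem_erase hf))
      omega
  by_cases hd : Disjoint (L p) (L q)
  · by_cases hd' : Disjoint (L p') (L q')
    · apply hallGood' D L M R _ hM
      intro T hT U hU k hk hkU
      have hc := card_le_card hT
      have g1 := hL p hp
      have g2 := hL q hq
      have g3 := hL p' hp'
      have g4 := hL q' hq'
      by_cases hpq : p ∈ T ∧ q ∈ T
      · have := card_le_card (union_subset (hU p hpq.1) (hU q hpq.2))
        rw [card_union_of_disjoint hd] at this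
        omega
      by_cases hpq' : p' ∈ T ∧ q' ∈ T
      · have := card_le_card (union_subset (hU p' hpq'.1) (hU q' hpq'.2))
        rw [card_union_of_disjoint hd'] at this
        omega
      have hlt : #T + 2 ≤ #R := by
        obtain ⟨a, ha, haT, ha'⟩ : ∃ a ∈ R, a ∉ T ∧ (a = p ∨ a = q) := by
          by_cases h : p ∈ T
          · exact ⟨q, hq, fun h' => hpq ⟨h, h'⟩, Or.inr rfl⟩
          · exact ⟨p, hp, h, Or.inl rfl⟩
        obtain ⟨b, hb, hbT, hb'⟩ : ∃ a ∈ R, a ∉ T ∧ (a = p' ∨ a = q') := by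
          by_cases h : p' ∈ T
          · exact ⟨q', hq', fun h' => hpq' ⟨h, h'⟩, Or.inr rfl⟩
          · exact ⟨p', hp', h, Or.inl rfl⟩
        have hab : a ≠ b := by
          rcases ha' with rfl | rfl <;> rcases hb' with rfl | rfl <;> assumption
        have := card_erase2 R a b ha hb hab
        have : T ⊆ (R.erase a).erase b := by
          intro x hx
          refine mem_erase.2 ⟨fun h => hbT (h ▸ hx), mem_erase.2 ⟨fun h => haT (h ▸ hx), hT hx⟩⟩
        have := card_le_card this
        omega
      rcases Nat.eq_zero_or_pos k with rfl | hk0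
      · rcases T.eq_empty_or_nonempty with rfl | ⟨f, hf⟩
        · simp
        · have := hL f (hT hf)
          have := card_le_card (hU f hf)
          omega
      · have := hkU hk0
        omega
    · exact main p' q' p q hp' hq' hp hq hpq' hn' hpq hn h1.symm h3.symm h2.symm h4.symm hd'
  · exact main p q p' q' hp hq hp' hq' hpq hn hpq' hn' h1 h2 h3 h4 hd

end SEC

namespace SEC
open Finset

lemma weight {α : Type*} [DecidableEq α] (D : SimpleGraph α) (b : α → Fin 4)
    (hmat : ∀ f g g', D.Adj f g → D.Adj f g' → b f ≠ b g → b g = b g' → g = g')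
    (htri : ∀ f g h, D.Adj f g → D.Adj g h → D.Adj f h → b f ≠ b g → b g ≠ b h → b f ≠ b h → False)
    (L : α → Finset ℕ) (T : Finset α) (U : Finset ℕ) (hLU : ∀ f ∈ T, L f ⊆ U)
    (hns : ∀ f ∈ T, ∀ g ∈ T, f ≠ g → ¬ D.Adj f g → Disjoint (L f) (L g))
    (s : Fin 4 → ℚ) (hs0 : ∀ i, 0 ≤ s i) (hs1 : ∀ i, #{f ∈ T | b f = i} * s i ≤ 1)
    (hs2 : ∀ f ∈ T, ∀ g ∈ T, b f ≠ b g → D.Adj f g → s (b f) + s (b g) ≤ 1) :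
    ∑ f ∈ T, s (b f) * #(L f) ≤ #U := by
  have e1 : ∀ f ∈ T, s (b f) * (#(L f) : ℚ) = ∑ c ∈ U, if c ∈ L f then s (b f) else 0 := by
    intro f hf
    rw [← sum_filter, sum_const, nsmul_eq_mul, filter_mem_eq_inter,
      inter_eq_right.2 (hLU f hf), mul_comm]
  rw [sum_congr rfl e1, sum_comm]
  have e2 : ∀ c ∈ U, (∑ f ∈ T, if c ∈ L f then s (b f) else 0) ≤ 1 := by
    intro c _
    rw [← sum_filter]
    set P := {f ∈ T | c ∈ L f} with hP
    have hadj : ∀ f ∈ P, ∀ g ∈ P, f ≠ g → D.Adj f g := by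
      intro f hf g hg hfg
      by_contra hn
      rw [hP, mem_filter] at hf hg
      exact disjoint_left.1 (hns f hf.1 g hg.1 hfg hn) hf.2 hg.2
    by_cases hsame : ∃ i, ∀ f ∈ P, b f = i
    · obtain ⟨i, hi⟩ := hsame
      rw [sum_congr rfl (fun f hf => by rw [hi f hf]), sum_const, nsmul_eq_mul]
      refine le_trans ?_ (hs1 i)
      refine mul_le_mul_of_nonneg_right ?_ (hs0 i)
      exact_mod_cast card_le_card (fun f hf => mem_filter.2 ⟨(mem_filter.1 hf).1, hi f hf⟩)
    · push Not at hsame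
      obtain ⟨f, hf, -⟩ := hsame 0
      obtain ⟨g, hg, hfg⟩ := hsame (b f)
      have hne : f ≠ g := fun h => hfg (by rw [h])
      have hPe : P = {f, g} := by
        ext h
        simp only [mem_insert, mem_singleton]
        constructor
        · intro hh
          by_contra hn
          push Not at hn
          have a1 := hadj f hf g hg hne
          have a2 := hadj f hf h hh hn.1.symm
          have a3 := hadj g hg h hh hn.2.symm
          by_cases c1 : b f = b h
          · exact hn.1 (hmat g f h a1.symm a3 hfg c1).symm
          by_cases c2 : b g = b h
          · exact hn.2 (hmat f g h a1 a2 hfg.symm c2).symm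
          exact htri f g h a1 a3 a2 hfg.symm c2 c1
        · rintro (rfl | rfl) <;> assumption
      rw [hPe, sum_pair hne]
      exact hs2 f (mem_filter.1 hf).1 g (mem_filter.1 hg).1 hfg.symm (hadj f hf g hg hne)
  calc _ ≤ ∑ c ∈ U, (1 : ℚ) := sum_le_sum e2
    _ = #U := by simp

set_option maxHeartbeats 2000000 in
lemma share {α : Type*} [DecidableEq α] (D : SimpleGraph α) [DecidableRel D.Adj] (b : α → Fin 4)
    (hb : ∀ f g, f ≠ g → b f = b g → D.Adj f g)
    (hmat : ∀ f g g', D.Adj f g → D.Adj f g' → b f ≠ b g → b g = b g' → g = g')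
    (htri : ∀ f g h, D.Adj f g → D.Adj g h → D.Adj f h → b f ≠ b g → b g ≠ b h → b f ≠ b h → False)
    (L : α → Finset ℕ) (R T : Finset α) (U : Finset ℕ) (hTR : T ⊆ R) (hLU : ∀ f ∈ T, L f ⊆ U)
    (hUT : #U ≤ #T + 3) (hne : ∀ i, 1 ≤ #{f ∈ T | b f = i})
    (hInv : ∀ f ∈ R, #{g ∈ R | D.Adj f g} + 2 ≤ #(L f))
    (hcond : (∀ f ∈ T, ∀ g ∈ T, f ≠ g → #{h ∈ T | b h = b f} = 1 → #{h ∈ T | b h = b g} = 1 →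
        (∃ h ∈ T, D.Adj f h) → (∃ h ∈ T, D.Adj g h) → 4 ≤ #(L f) ∨ 4 ≤ #(L g)) ∨
      (∀ f ∈ T, ∀ g ∈ T, D.Adj f g → #{h ∈ T | b h = b f} = 1 → 3 ≤ #{h ∈ T | b h = b g})) :
    ∃ f ∈ T, ∃ g ∈ T, f ≠ g ∧ ¬ D.Adj f g ∧ ∃ γ, γ ∈ L f ∧ γ ∈ L g := by
  classical
  by_contra hcon
  have hns : ∀ f ∈ T, ∀ g ∈ T, f ≠ g → ¬ D.Adj f g → Disjoint (L f) (L g) := by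
    intro f hf g hg hfg hn
    rw [disjoint_left]
    intro c h1 h2
    exact hcon ⟨f, hf, g, hg, hfg, hn, c, h1, h2⟩
  -- generic contradiction
  obtain ⟨m, hm⟩ : ∃ m : Fin 4 → ℕ, ∀ i, #{f ∈ T | b f = i} = m i := ⟨_, fun _ => rfl⟩
  have hmT : ∑ i, m i = #T := by
    simp only [← hm]
    exact (card_eq_sum_card_fiberwise (fun f _ => mem_univ (b f))).symm
  simp only [hm] at hne hcond
  set X : Fin 4 → Prop := fun i => ∃ f ∈ T, b f = i ∧ ∃ g ∈ T, D.Adj f g with hX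
  set bad : Fin 4 → Prop := fun i => m i = 1 ∧ X i ∧ ∀ f ∈ T, b f = i → #(L f) ≤ 3 with hbad
  have gen : ∀ σ δ : ℚ, 1 / 2 ≤ σ → σ ≤ 1 → (2 - δ ≤ 3 * σ) → 0 ≤ δ →
      (∀ f ∈ T, ∀ g ∈ T, b f ≠ b g → D.Adj f g → m (b f) = 1 → m (b g) = 1 → 2 * σ ≤ 1) →
      (∀ f ∈ T, ∀ g ∈ T, b f ≠ b g → D.Adj f g → m (b f) = 1 → 2 ≤ m (b g) →
        σ + 1 / (m (b g) : ℚ) ≤ 1) →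
      (#{i | bad i} * δ < 1) → False := by
    intro σ δ hσ1 hσ2 hδ hδ0 hA hB hC
    set s : Fin 4 → ℚ := fun i => if 2 ≤ m i then 1 / (m i : ℚ) else if X i then σ else 1 with hs
    have sbig : ∀ i, 2 ≤ m i → s i = 1 / (m i : ℚ) := fun i hi => by simp [hs, hi]
    have hm1 : ∀ i, ¬ 2 ≤ m i → m i = 1 := fun i hi => by have := hne i; omega
    have hw := weight D b hmat htri L T U hLU hns s ?_ ?_ ?_
    · have hsum : ∑ f ∈ T, s (b f) * #(L f) = ∑ i, ∑ f ∈ T with b f = i, s (b f) * (#(L f) : ℚ) :=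
        (sum_fiberwise T b _).symm
      have hbr : ∀ i, (m i : ℚ) + 1 - (if bad i then δ else 0) ≤
          ∑ f ∈ T with b f = i, s (b f) * (#(L f) : ℚ) := by
        intro i
        have hsi : ∑ f ∈ T with b f = i, s (b f) * (#(L f) : ℚ) =
            ∑ f ∈ T with b f = i, s i * (#(L f) : ℚ) :=
          sum_congr rfl (fun f hf => by rw [(mem_filter.1 hf).2])
        rw [hsi]
        -- lower bound for lists
        have hlow : ∀ f ∈ T, b f = i → m i + 1 ≤ #(L f) := by
          intro f hf hfi
          have h1 := hInv f (hTR hf)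
          have h2 : ({h ∈ T | b h = i}).erase f ⊆ {g ∈ R | D.Adj f g} := by
            intro h hh
            simp only [mem_erase, mem_filter] at hh ⊢
            exact ⟨hTR hh.2.1, hb f h hh.1.symm (hfi.trans hh.2.2.symm)⟩
          have h3 := card_le_card h2
          have h4 : #(({h ∈ T | b h = i}).erase f) + 1 = m i :=
            (card_erase_add_one (mem_filter.2 ⟨hf, hfi⟩)).trans (hm i)
          omega
        by_cases h2 : 2 ≤ m i
        · have hnb : ¬ bad i := fun h => by have := h.1; omega
          rw [if_neg hnb, sbig i h2]
          have hmpos : (0 : ℚ) < m i := Nat.cast_pos.2 (by omega)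
          have : ∑ f ∈ T with b f = i, (1 / (m i : ℚ)) * ((m i : ℚ) + 1) ≤
              ∑ f ∈ T with b f = i, 1 / (m i : ℚ) * (#(L f) : ℚ) := by
            apply sum_le_sum
            intro f hf
            refine mul_le_mul_of_nonneg_left ?_ (by positivity)
            exact_mod_cast hlow f (mem_filter.1 hf).1 (mem_filter.1 hf).2
          refine le_trans (le_of_eq ?_) this
          rw [sum_const, nsmul_eq_mul]
          rw [hm]
          field_simp
          ring
        · have h1 := hm1 i h2
          obtain ⟨f, hf⟩ := card_eq_one.1 ((hm i).trans h1)
          have hfm : f ∈ ({f ∈ T | b f = i} : Finset α) := by rw [hf]; simp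
          have h1q : (m i : ℚ) = 1 := by rw [h1]; simp
          rw [hf, sum_singleton, h1q]
          have hfT := (mem_filter.1 hfm).1
          have hfi := (mem_filter.1 hfm).2
          have huniq : ∀ g ∈ T, b g = i → g = f := by
            intro g hg hgi
            have : g ∈ ({f ∈ T | b f = i} : Finset α) := mem_filter.2 ⟨hg, hgi⟩
            rw [hf] at this
            simpa using this
          have hlf := hlow f hfT hfi
          by_cases hXi : X i
          · have hsσ : s i = σ := by simp [hs, h2, hXi]
            rw [hsσ]
            have h3 : 3 ≤ #(L f) := by
              obtain ⟨f', hf', hfi', g, hg, hfg⟩ := hXi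
              obtain rfl := huniq f' hf' hfi'
              have h1 := hInv f' (hTR hf')
              have : 0 < #{g ∈ R | D.Adj f' g} := card_pos.2 ⟨g, mem_filter.2 ⟨hTR hg, hfg⟩⟩
              omega
            by_cases hbi : bad i
            · rw [if_pos hbi]
              have h3' : (3 : ℚ) ≤ #(L f) := by exact_mod_cast h3
              push_cast
              nlinarith
            · rw [if_neg hbi]
              have h4 : 4 ≤ #(L f) := by
                by_contra h4
                apply hbi
                refine ⟨h1, hXi, fun g hg hgi => ?_⟩
                rw [huniq g hg hgi]
                omega
              have h4' : (4 : ℚ) ≤ #(L f) := by exact_mod_cast h4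
              push_cast
              nlinarith
          · have hsσ : s i = 1 := by simp [hs, h2, hXi]
            have hnb : ¬ bad i := fun h => hXi h.2.1
            rw [hsσ, if_neg hnb]
            have : (2 : ℚ) ≤ #(L f) := by exact_mod_cast (by omega : 2 ≤ #(L f))
            push_cast
            linarith
      have htot : ∑ i, ((m i : ℚ) + 1 - (if bad i then δ else 0)) ≤ #U := by
        refine le_trans (sum_le_sum (fun i _ => hbr i)) ?_
        rw [← hsum]; exact hw
      rw [sum_sub_distrib, sum_add_distrib, ← sum_filter, sum_const, sum_const] at htot
      have : ((∑ i, m i : ℕ) : ℚ) = #T := by rw [hmT]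
      push_cast at this
      rw [this] at htot
      have hUT' : (#U : ℚ) ≤ #T + 3 := by exact_mod_cast hUT
      simp only [nsmul_eq_mul, card_univ, Fintype.card_fin] at htot
      push_cast at htot
      linarith
    · intro i
      simp only [hs]
      split_ifs
      · positivity
      · linarith
      · norm_num
    · intro i
      rw [hm]
      by_cases h2 : 2 ≤ m i
      · rw [sbig i h2]
        have hmpos : (0 : ℚ) < m i := Nat.cast_pos.2 (by omega)
        rw [mul_one_div_cancel hmpos.ne']
      · rw [hm1 i h2]
        simp only [hs, if_neg h2]
        split_ifs <;> simp [hσ2]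
    · intro f hf g hg hfg hadj
      have hXf : X (b f) := ⟨f, hf, rfl, g, hg, hadj⟩
      have hXg : X (b g) := ⟨g, hg, rfl, f, hf, hadj.symm⟩
      have half : ∀ i, 2 ≤ m i → (1 / (m i : ℚ)) ≤ 1 / 2 := by
        intro i hi
        have : (2 : ℚ) ≤ m i := by exact_mod_cast hi
        exact one_div_le_one_div_of_le (by norm_num) this
      by_cases h1 : 2 ≤ m (b f) <;> by_cases h2 : 2 ≤ m (b g)
      · rw [sbig _ h1, sbig _ h2]
        have := half _ h1
        have := half _ h2
        linarith
      · have : s (b g) = σ := by simp [hs, h2, hXg]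
        rw [sbig _ h1, this, add_comm]
        exact hB g hg f hf hfg.symm hadj.symm (hm1 _ h2) h1
      · have : s (b f) = σ := by simp [hs, h1, hXf]
        rw [sbig _ h2, this]
        exact hB f hf g hg hfg hadj (hm1 _ h1) h2
      · have e1 : s (b g) = σ := by simp [hs, h2, hXg]
        have e2 : s (b f) = σ := by simp [hs, h1, hXf]
        rw [e1, e2]
        have := hA f hf g hg hfg hadj (hm1 _ h1) (hm1 _ h2)
        linarith
  rcases hcond with hc | hc
  · refine gen (1 / 2) (1 / 2) (by norm_num) (by norm_num) (by norm_num) (by norm_num)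
      (fun _ _ _ _ _ _ _ _ => by norm_num) (fun f hf g hg hfg had h1 h2 => ?_) ?_
    · have : (2 : ℚ) ≤ m (b g) := by exact_mod_cast h2
      have := one_div_le_one_div_of_le (by norm_num) this
      linarith
    · have hle : #{i | bad i} ≤ 1 := by
        rw [card_le_one]
        intro i hi j hj
        rw [mem_filter] at hi hj
        by_contra hij
        obtain ⟨-, hi1, ⟨f, hf, hfi, h, hh, hfh⟩, hi3⟩ := hi
        obtain ⟨-, hj1, ⟨g, hg, hgj, h', hh', hgh'⟩, hj3⟩ := hj
        have := hc f hf g hg (fun h => hij (by rw [← hfi, ← hgj, h])) (by rw [hfi]; exact hi1)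
          (by rw [hgj]; exact hj1) ⟨h, hh, hfh⟩ ⟨h', hh', hgh'⟩
        have := hi3 f hf hfi
        have := hj3 g hg hgj
        omega
      have : (#{i | bad i} : ℚ) ≤ 1 := by exact_mod_cast hle
      linarith
  · refine gen (2 / 3) 0 (by norm_num) (by norm_num) (by norm_num) (by norm_num)
      (fun f hf g hg hfg had h1 h2 => ?_) (fun f hf g hg hfg had h1 h2 => ?_) (by norm_num)
    · have : 3 ≤ m (b g) := hc f hf g hg had h1
      omega
    · have h3 : 3 ≤ m (b g) := hc f hf g hg had h1
      have : (3 : ℚ) ≤ m (b g) := by exact_mod_cast h3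
      have := one_div_le_one_div_of_le (by norm_num) this
      linarith

end SEC

namespace SEC
open Finset

structure Gad {α : Type*} (D : SimpleGraph α) (b : α → Fin 4) : Prop where
  hb : ∀ f g, f ≠ g → b f = b g → D.Adj f g
  hmat : ∀ f g g', D.Adj f g → D.Adj f g' → b f ≠ b g → b g = b g' → g = g'
  htri : ∀ f g h, D.Adj f g → D.Adj g h → D.Adj f h → b f ≠ b g → b g ≠ b h → b f ≠ b h → False

def bs {α : Type*} (b : α → Fin 4) (R : Finset α) (i : Fin 4) : ℕ := #{f ∈ R | b f = i}

lemma bs_sum {α : Type*} (b : α → Fin 4) (R : Finset α) :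
    bs b R 0 + bs b R 1 + bs b R 2 + bs b R 3 = #R := by
  rw [← Fin.sum_univ_four (bs b R)]
  exact (card_eq_sum_card_fiberwise (fun f _ => mem_univ (b f))).symm

lemma bs_erase {α : Type*} [DecidableEq α] (b : α → Fin 4) (R : Finset α) (f : α) (hf : f ∈ R)
    (i : Fin 4) : bs b (R.erase f) i + (if b f = i then 1 else 0) = bs b R i := by
  unfold bs
  rw [filter_erase]
  split_ifs with h
  · exact card_erase_add_one (mem_filter.2 ⟨hf, h⟩)
  · rw [erase_eq_of_notMem (by simp [h])]; simp

lemma bs_erase2 {α : Type*} [DecidableEq α] (b : α → Fin 4) (R : Finset α) (f g : α) (hf : f ∈ R)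
    (hg : g ∈ R) (hfg : f ≠ g) (i : Fin 4) : bs b ((R.erase f).erase g) i +
      (if b f = i then 1 else 0) + (if b g = i then 1 else 0) = bs b R i := by
  have h1 := bs_erase b R f hf i
  have h2 := bs_erase b (R.erase f) g (mem_erase.2 ⟨hfg.symm, hg⟩) i
  omega

lemma bs_single {α : Type*} (b : α → Fin 4) (R : Finset α) (f g : α) (hf : f ∈ R)
    (hg : g ∈ R) (hfg : b f = b g) (h : bs b R (b f) = 1) : f = g := by
  obtain ⟨x, hx⟩ := card_eq_one.1 h
  have h1 : f ∈ ({x} : Finset α) := hx ▸ mem_filter.2 ⟨hf, rfl⟩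
  have h2 : g ∈ ({x} : Finset α) := hx ▸ mem_filter.2 ⟨hg, hfg.symm⟩
  rw [mem_singleton] at h1 h2
  rw [h1, h2]

lemma bs_two {α : Type*} [DecidableEq α] (b : α → Fin 4) (R : Finset α) (f g h : α) (hf : f ∈ R)
    (hg : g ∈ R) (hh : h ∈ R) (hfg : b f = b g) (hfh : b f = b h) (h2 : bs b R (b f) = 2)
    (h1 : f ≠ g) (h3 : f ≠ h) : g = h := by
  by_contra hne
  have : ({f, g, h} : Finset α) ⊆ {x ∈ R | b x = b f} := by
    intro x hx
    simp only [mem_insert, mem_singleton] at hx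
    rw [mem_filter]
    rcases hx with rfl | rfl | rfl
    · exact ⟨hf, rfl⟩
    · exact ⟨hg, hfg.symm⟩
    · exact ⟨hh, hfh.symm⟩
  have h4 := card_le_card this
  rw [card_eq_three.2 ⟨f, g, h, h1, h3, hne, rfl⟩] at h4
  unfold bs at h2
  omega

lemma bs_mono_loss {α : Type*} [DecidableEq α] (b : α → Fin 4) (R T : Finset α) (h : T ⊆ R)
    (i : Fin 4) : bs b R i + #T ≤ bs b T i + #R := by
  have h1 : ({f ∈ R | b f = i}) ⊆ {f ∈ T | b f = i} ∪ (R \ T) := by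
    intro x hx
    simp only [mem_filter, mem_union, mem_sdiff] at hx ⊢
    tauto
  have h2 := card_le_card h1
  have h3 := card_union_le {f ∈ T | b f = i} (R \ T)
  have h4 := card_sdiff_add_card_eq_card h
  unfold bs
  omega

lemma bs_mono {α : Type*} (b : α → Fin 4) (R T : Finset α) (h : T ⊆ R)
    (i : Fin 4) : bs b T i ≤ bs b R i := card_le_card (filter_subset_filter _ h)

def Inv {α : Type*} (D : SimpleGraph α) [DecidableRel D.Adj] (R : Finset α) (L : α → Finset ℕ) :
    Prop := ∀ f ∈ R, #{g ∈ R | D.Adj f g} + 2 ≤ #(L f)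

lemma inv_step {α : Type*} [DecidableEq α] (D : SimpleGraph α) [DecidableRel D.Adj] (R : Finset α)
    (L : α → Finset ℕ) (f g : α) (γ : ℕ) (hf : f ∈ R) (hg : g ∈ R) (h : Inv D R L) :
    Inv D ((R.erase f).erase g) (Lnew D L f g γ) := by
  intro x hx
  have hxR : x ∈ R := mem_of_mem_erase (mem_of_mem_erase hx)
  have h1 := h x hxR
  have key : ∀ p ∈ R, (p = f ∨ p = g) → D.Adj x p →
      #{y ∈ (R.erase f).erase g | D.Adj x y} + 1 ≤ #{y ∈ R | D.Adj x y} := by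
    intro p hp hpp hxp
    apply card_lt_card
    refine ⟨fun y hy => ?_, fun hsub => ?_⟩
    · simp only [mem_filter, mem_erase] at hy ⊢
      tauto
    · have := hsub (mem_filter.2 ⟨hp, hxp⟩)
      simp only [mem_filter, mem_erase] at this
      tauto
  have hLn := Lnew_card D L f g γ x
  by_cases c1 : D.Adj x f
  · have := key f hf (Or.inl rfl) c1
    omega
  by_cases c2 : D.Adj x g
  · have := key g hg (Or.inr rfl) c2
    omega
  have : Lnew D L f g γ x = L x := by unfold Lnew; simp [c1, c2]
  rw [this]
  have : #{y ∈ (R.erase f).erase g | D.Adj x y} ≤ #{y ∈ R | D.Adj x y} := by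
    apply card_le_card
    intro y hy
    simp only [mem_filter, mem_erase] at hy ⊢
    tauto
  omega

lemma stage3 {α : Type*} [DecidableEq α] (D : SimpleGraph α) [DecidableRel D.Adj] (R : Finset α)
    (L : α → Finset ℕ) (M : Fin 4 → Finset ℕ) (hR : #R ≤ 6) (hM : ∀ i, 10 ≤ #(M i))
    (hI : Inv D R L) : Good D R L M := by
  by_contra hng
  obtain ⟨T, hT, U, h1, h2, -⟩ := obstruct D L M R 10 (fun f hf => by have := hI f hf; omega) hM hng
  have := card_le_card hT
  omega

lemma other3 (m : Fin 4 → ℕ) (h3 : ∀ i, m i ≤ 3) (hs : 8 ≤ m 0 + m 1 + m 2 + m 3) (i j k : Fin 4)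
    (hij : i ≠ j) (hi : m i = 1) (hj : m j = 1) (hki : k ≠ i) (hkj : k ≠ j) : 3 ≤ m k := by
  have a0 := h3 0
  have a1 := h3 1
  have a2 := h3 2
  have a3 := h3 3
  fin_cases i <;> fin_cases j <;> fin_cases k <;> simp at * <;> omega

lemma two1 (m : Fin 4 → ℕ) (h3 : ∀ i, m i ≤ 3) (hs : 10 ≤ m 0 + m 1 + m 2 + m 3) (i j : Fin 4)
    (hij : i ≠ j) (hi : m i = 1) (hj : m j = 1) : False := by
  have a0 := h3 0
  have a1 := h3 1
  have a2 := h3 2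
  have a3 := h3 3
  fin_cases i <;> fin_cases j <;> simp at * <;> omega

lemma stage2 {α : Type*} [DecidableEq α] (D : SimpleGraph α) [DecidableRel D.Adj] (b : α → Fin 4)
    (hG : Gad D b) (R : Finset α)
    (L : α → Finset ℕ) (M : Fin 4 → Finset ℕ) (hR : #R = 8) (hb1 : ∀ i, 1 ≤ bs b R i)
    (hb3 : ∀ i, bs b R i ≤ 3) (hM : ∀ i, 11 ≤ #(M i)) (hI : Inv D R L)
    (hs : ∀ f ∈ R, ∀ g ∈ R, f ≠ g → bs b R (b f) = 1 → bs b R (b g) = 1 → D.Adj f g →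
      4 ≤ #(L f) ∨ 4 ≤ #(L g)) : Good D R L M := by
  by_contra hng
  obtain ⟨T, hT, U, h1, h2, hLU⟩ :=
    obstruct D L M R 11 (fun f hf => by have := hI f hf; omega) hM hng
  obtain rfl : T = R := eq_of_subset_of_card_le hT (by omega)
  obtain ⟨p, hp, q, hq, hpq, hn, γ, e1, e2⟩ := share D b hG.hb hG.hmat hG.htri L T T U hT hLU h2 hb1 hI
    (by
      change (∀ f ∈ T, ∀ g ∈ T, f ≠ g → bs b T (b f) = 1 → bs b T (b g) = 1 →
        (∃ h ∈ T, D.Adj f h) → (∃ h ∈ T, D.Adj g h) → 4 ≤ #(L f) ∨ 4 ≤ #(L g)) ∨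
        (∀ f ∈ T, ∀ g ∈ T, D.Adj f g → bs b T (b f) = 1 → 3 ≤ bs b T (b g))
      by_cases hA : ∃ f ∈ T, ∃ g ∈ T, f ≠ g ∧ bs b T (b f) = 1 ∧ bs b T (b g) = 1 ∧ ¬ D.Adj f g
      · right
        obtain ⟨f, hf, g, hg, hfg, hf1, hg1, hna⟩ := hA
        have hbb : b f ≠ b g := fun h => hna (hG.hb f g hfg h)
        have ho := fun k => other3 (bs b T) hb3 (by rw [bs_sum]; omega) (b f) (b g) k hbb hf1 hg1
        intro x hx y hy hxy hx1
        by_cases k1 : b y = b f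
        · have : y = f := bs_single b T y f hy hf k1 (by rw [k1]; exact hf1)
          subst this
          by_cases k2 : b x = b y
          · exact absurd (bs_single b T x y hx hy k2 hx1) hxy.ne
          by_cases k3 : b x = b g
          · obtain rfl := bs_single b T x g hx hg k3 hx1
            exact absurd hxy.symm hna
          · have := ho _ k2 k3
            omega
        by_cases k1' : b y = b g
        · have : y = g := bs_single b T y g hy hg k1' (by rw [k1']; exact hg1)
          subst this
          by_cases k2 : b x = b y
          · exact absurd (bs_single b T x y hx hy k2 hx1) hxy.ne
          by_cases k3 : b x = b f
          · obtain rfl := bs_single b T x f hx hf k3 hx1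
            exact absurd hxy hna
          · have := ho _ k3 k2
            omega
        exact ho _ k1 k1'
      · left
        intro f hf g hg hfg hf1 hg1 _ _
        refine hs f hf g hg hfg hf1 hg1 ?_
        by_contra hna
        exact hA ⟨f, hf, g, hg, hfg, hf1, hg1, hna⟩)
  refine hng (pairStep D L M T p q γ hn e1 e2 (stage3 D _ _ _ ?_ ?_ (inv_step D T L p q γ hp hq hI)))
  · have := card_erase2 T p q hp hq hpq
    omega
  · intro i
    have := erase_card (M i) γ
    have := hM i
    omega

lemma stage1 {α : Type*} [DecidableEq α] (D : SimpleGraph α) [DecidableRel D.Adj] (b : α → Fin 4)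
    (hG : Gad D b) (R : Finset α)
    (L : α → Finset ℕ) (M : Fin 4 → Finset ℕ) (hR : #R = 10) (hb2 : ∀ i, 2 ≤ bs b R i)
    (hb3 : ∀ i, bs b R i ≤ 3) (hM : ∀ i, 12 ≤ #(M i)) (hI : Inv D R L) : Good D R L M := by
  by_contra hng
  obtain ⟨T, hT, U, h1, h2, hLU⟩ :=
    obstruct D L M R 12 (fun f hf => by have := hI f hf; omega) hM hng
  -- list size
  have four : ∀ f ∈ R, ∀ g ∈ R, ∀ h ∈ R, f ≠ h → b f = b h → b f ≠ b g → D.Adj f g → 4 ≤ #(L f) := by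
    intro f hf g hg h hh hfh hbh hbg hfg
    have h1 := hI f hf
    have : ({g, h} : Finset α) ⊆ {g ∈ R | D.Adj f g} := by
      intro x hx
      simp only [mem_insert, mem_singleton] at hx
      rw [mem_filter]
      rcases hx with rfl | rfl
      · exact ⟨hg, hfg⟩
      · exact ⟨hh, hG.hb _ _ hfh hbh⟩
    have h4 := card_le_card this
    rw [card_pair (fun e => hbg (by rw [hbh, e]))] at h4
    omega
  have hsib : ∀ f ∈ R, ∃ h ∈ R, f ≠ h ∧ b f = b h := by
    intro f hf
    have := hb2 (b f)
    have hlt : 1 < #{x ∈ R | b x = b f} := this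
    obtain ⟨h, hh, hhf⟩ := exists_mem_ne hlt f
    rw [mem_filter] at hh
    exact ⟨h, hh.1, hhf.symm, hh.2.symm⟩
  obtain ⟨p, hp, q, hq, hpq, hn, γ, e1, e2⟩ := share D b hG.hb hG.hmat hG.htri L R T U hT hLU h2
    (fun i => by
      have := bs_mono_loss b R T hT i
      have := hb2 i
      change 1 ≤ bs b T i
      omega) hI
    (by
      left
      intro f hf g hg hfg hf1 hg1 hx _
      left
      obtain ⟨x, hx, hfx⟩ := hx
      obtain ⟨h, hh, hfh, hbh⟩ := hsib f (hT hf)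
      refine four f (hT hf) x (hT hx) h hh hfh hbh ?_ hfx
      intro hb
      exact hfx.ne (bs_single b T f x hf hx hb hf1))
  have hpR := hT hp
  have hqR := hT hq
  have fin : ∀ p ∈ R, ∀ q ∈ R, p ≠ q → ¬ D.Adj p q → γ ∈ L p → γ ∈ L q →
      (∀ x ∈ R, ∀ y ∈ R, b x = b p → b y = b q → x ≠ p → y ≠ q → bs b R (b p) = 2 →
        bs b R (b q) = 2 → D.Adj x y → 4 ≤ #(Lnew D L p q γ x)) → False := by
    intro p hp q hq hpq hn e1 e2 hl
    have hbb : b p ≠ b q := fun h => hn (hG.hb p q hpq h)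
    have he := bs_erase2 b R p q hp hq hpq
    refine hng (pairStep D L M R p q γ hn e1 e2 (stage2 D b hG _ _ _ ?_ ?_ ?_ ?_
      (inv_step D R L p q γ hp hq hI) ?_))
    · have := card_erase2 R p q hp hq hpq
      omega
    · intro i
      have := he i
      have := hb2 i
      split_ifs at * with k1 k2
      · exact absurd (k1.trans k2.symm) hbb
      all_goals omega
    · intro i
      have := he i
      have := hb3 i
      omega
    · intro i
      have := erase_card (M i) γ
      have := hM i
      omega
    · intro x hx y hy hxy hx1 hy1 hadj
      have hbxy : b x ≠ b y := fun h => hxy (bs_single b _ x y hx hy h hx1)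
      have hx' := he (b x)
      have hy' := he (b y)
      have hx2 := hb2 (b x)
      have hy2 := hb2 (b y)
      simp only [mem_erase] at hx hy
      rw [hx1] at hx'
      rw [hy1] at hy'
      by_cases k1 : b p = b x
      · have k2 : b q = b y := by
          by_contra k2
          rw [if_neg (by rw [k1]; exact hbxy), if_neg k2] at hy'
          omega
        left
        refine hl x hx.2.2 y hy.2.2 k1.symm k2.symm hx.2.1 hy.1 ?_ ?_ hadj
        · rw [k1, ← hx', if_pos k1, if_neg (fun h => hbb (k1.trans h.symm))]
        · rw [k2, ← hy', if_pos k2, if_neg (fun h => hbb (h.trans k2.symm))]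
      · have k1' : b q = b x := by
          by_contra k2
          rw [if_neg k1, if_neg k2] at hx'
          omega
        have k2 : b p = b y := by
          by_contra k2
          rw [if_neg k2, if_neg (by rw [k1']; exact hbxy)] at hy'
          omega
        right
        refine hl y hy.2.2 x hx.2.2 k2.symm k1'.symm hy.2.1 hx.1 ?_ ?_ hadj.symm
        · rw [k2, ← hy', if_pos k2, if_neg (fun h => hbb (k2.trans h.symm))]
        · rw [k1', ← hx', if_pos k1', if_neg k1]
  have hbb : b p ≠ b q := fun h => hn (hG.hb p q hpq h)
  by_cases hbad : ∃ x ∈ R, ∃ y ∈ R, b x = b p ∧ b y = b q ∧ x ≠ p ∧ y ≠ q ∧ bs b R (b p) = 2 ∧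
      bs b R (b q) = 2 ∧ D.Adj x y ∧ γ ∈ L x
  · obtain ⟨x, hx, y, hy, hxp, hyq, nxp, nyq, p2, q2, hxy, hγ⟩ := hbad
    refine fin x hx q hqR (fun h => hbb (by rw [← hxp, h])) ?_ hγ e2 ?_
    · intro hxq
      exact nyq (hG.hmat x y q hxy hxq (by rw [hxp, hyq]; exact hbb) hyq)
    · intro x' hx' y' hy' k1 k2 k3 k4 k5 k6 k7
      exfalso
      obtain rfl := bs_two b R x x' p hx hx' hpR k1.symm hxp (by rw [hxp]; exact p2) k3.symm nxp
      obtain rfl := bs_two b R q y' y hqR hy' hy k2.symm hyq.symm q2 k4.symm nyq.symm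
      exact nxp (hG.hmat y' x x' hxy.symm k7.symm (by rw [hyq, hxp]; exact hbb.symm) hxp)
  · refine fin p hpR q hqR hpq hn e1 e2 ?_
    intro x hx y hy k1 k2 k3 k4 k5 k6 k7
    have hγ : γ ∉ L x := fun h => hbad ⟨x, hx, y, hy, k1, k2, k3, k4, k5, k6, k7, h⟩
    have : Lnew D L p q γ x = L x := by
      unfold Lnew
      split_ifs
      · exact erase_eq_of_notMem hγ
      · rfl
    rw [this]
    exact four x hx y hy p hpR k3 k1 (by rw [k1, k2]; exact hbb) k7

lemma stage0 {α : Type*} [DecidableEq α] (D : SimpleGraph α) [DecidableRel D.Adj] (b : α → Fin 4)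
    (hG : Gad D b) (R : Finset α)
    (L : α → Finset ℕ) (M : Fin 4 → Finset ℕ) (hb3 : ∀ i, bs b R i = 3)
    (hM : ∀ i, 13 ≤ #(M i)) (hI : Inv D R L) : Good D R L M := by
  have hR : #R = 12 := by rw [← bs_sum b R, hb3, hb3, hb3, hb3]
  by_contra hng
  obtain ⟨T, hT, U, h1, h2, hLU⟩ :=
    obstruct D L M R 13 (fun f hf => by have := hI f hf; omega) hM hng
  obtain ⟨p, hp, q, hq, hpq, hn, γ, e1, e2⟩ := share D b hG.hb hG.hmat hG.htri L R T U hT hLU h2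
    (fun i => by
      have := bs_mono_loss b R T hT i
      have := hb3 i
      change 1 ≤ bs b T i
      omega) hI
    (by
      left
      intro f hf g hg hfg hf1 hg1 _ _
      exfalso
      refine two1 (bs b T) (fun i => (bs_mono b R T hT i).trans (hb3 i).le) ?_ (b f) (b g) ?_ hf1 hg1
      · rw [bs_sum]; omega
      · intro h
        exact hfg (bs_single b T f g hf hg h hf1))
  have hpR := hT hp
  have hqR := hT hq
  have hbb : b p ≠ b q := fun h => hn (hG.hb p q hpq h)
  have he := bs_erase2 b R p q hpR hqR hpq
  refine hng (pairStep D L M R p q γ hn e1 e2 (stage1 D b hG _ _ _ ?_ ?_ ?_ ?_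
      (inv_step D R L p q γ hpR hqR hI)))
  · have := card_erase2 R p q hpR hqR hpq
    omega
  · intro i
    have := he i
    have := hb3 i
    split_ifs at * with k1 k2
    · exact absurd (k1.trans k2.symm) hbb
    all_goals omega
  · intro i
    have := he i
    have := hb3 i
    omega
  · intro i
    have := erase_card (M i) γ
    have := hM i
    omega

end SEC

namespace SEC
open Finset

def Col {V : Type*} (G : SimpleGraph V) (L : Sym2 V → Finset ℕ) (A : Finset (Sym2 V)) : Prop :=
  ∃ c : Sym2 V → ℕ, (∀ e ∈ A, c e ∈ L e) ∧ ∀ e ∈ A, ∀ e' ∈ A, e ≠ e' → EdgeClose G e e' → c e ≠ c e'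

structure MinBad {V : Type*} [Fintype V] (G : SimpleGraph V) [DecidableRel G.Adj]
    (L : Sym2 V → Finset ℕ) (A : Finset (Sym2 V)) : Prop where
  hΔ : ∀ v, G.degree v ≤ 4
  hA : ∀ e ∈ A, e ∈ G.edgeSet
  hL : ∀ e ∈ G.edgeSet, 22 ≤ #(L e)
  hnc : ¬ Col G L A
  hmin : ∀ B ⊂ A, Col G L B

lemma EdgeClose.symm {V : Type*} {G : SimpleGraph V} {e e' : Sym2 V} (h : EdgeClose G e e') :
    EdgeClose G e' e := by
  obtain ⟨u, w, hu, hw, h⟩ := h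
  refine ⟨w, u, hw, hu, ?_⟩
  rcases h with h | h
  · exact Or.inl h.symm
  · exact Or.inr h.symm

noncomputable instance {V : Type*} (G : SimpleGraph V) (e e' : Sym2 V) :
    Decidable (EdgeClose G e e') := Classical.dec _

noncomputable def outs {V : Type*} [DecidableEq V] (G : SimpleGraph V) (A E : Finset (Sym2 V)) (e : Sym2 V) : ℕ :=
  #{e' ∈ A \ E | EdgeClose G e e'}

def oo {V : Type*} [DecidableEq V] (A E : Finset (Sym2 V)) (p : V) : ℕ :=
  #{e' ∈ A \ E | p ∈ e'}

section
variable {V : Type*} [Fintype V] [DecidableEq V] {G : SimpleGraph V} [DecidableRel G.Adj]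
  {L : Sym2 V → Finset ℕ} {A : Finset (Sym2 V)}

lemma reduce0 (H : MinBad G L A) (E : Finset (Sym2 V)) (hE : ∀ e ∈ E, e ∈ G.edgeSet)
    (hne : ∃ e ∈ E, e ∈ A)
    (h : ∀ M : Sym2 V → Finset ℕ, (∀ e ∈ E, 22 ≤ #(M e) + outs G A E e) → Col G M E) : False := by
  obtain ⟨e0, he0, he0A⟩ := hne
  obtain ⟨c, hc1, hc2⟩ := H.hmin (A \ E) ⟨sdiff_subset, fun hs => (mem_sdiff.1 (hs he0A)).2 he0⟩
  obtain ⟨d, hd1, hd2⟩ := h (fun e => L e \ image c {e' ∈ A \ E | EdgeClose G e e'}) (by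
    intro e he
    have h1 := H.hL e (hE e he)
    have h2 := le_card_sdiff (image c {e' ∈ A \ E | EdgeClose G e e'}) (L e)
    have h3 : #(image c {e' ∈ A \ E | EdgeClose G e e'}) ≤ outs G A E e := by
      unfold outs
      exact card_image_le
    omega)
  have hcross : ∀ e ∈ E, ∀ e' ∈ A, e' ∉ E → EdgeClose G e e' → d e ≠ c e' := by
    intro e he e' he' hn hcl heq
    have := (mem_sdiff.1 (hd1 e he)).2
    apply this
    rw [heq]
    exact mem_image_of_mem _ (mem_filter.2 ⟨mem_sdiff.2 ⟨he', hn⟩, hcl⟩)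
  apply H.hnc
  refine ⟨fun e => if e ∈ E then d e else c e, ?_, ?_⟩
  · intro e he
    by_cases hh : e ∈ E
    · simp only [if_pos hh]
      exact (mem_sdiff.1 (hd1 e hh)).1
    · simp only [if_neg hh]
      exact hc1 e (mem_sdiff.2 ⟨he, hh⟩)
  · intro e he e' he' hne hcl
    by_cases h1 : e ∈ E <;> by_cases h2 : e' ∈ E <;> simp only [h1, h2, if_true, if_false]
    · exact hd2 e h1 e' h2 hne hcl
    · exact hcross e h1 e' he' h2 hcl
    · exact (hcross e' h2 e he h1 (EdgeClose.symm hcl)).symm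
    · exact hc2 e (mem_sdiff.2 ⟨he, h1⟩) e' (mem_sdiff.2 ⟨he', h2⟩) hne hcl

lemma reduce {α : Type*} [Fintype α] (H : MinBad G L A) (E : Finset (Sym2 V))
    (hE : ∀ e ∈ E, e ∈ G.edgeSet)
    (hne : ∃ e ∈ E, e ∈ A) (ke : Fin 4 → Sym2 V) (fe : α → Sym2 V)
    (hke : ∀ i, ke i ∈ E) (hfe : ∀ f, fe f ∈ E)
    (hcov : ∀ e ∈ E, (∃ i, e = ke i) ∨ ∃ f, e = fe f) (D : SimpleGraph α)
    (hD : ∀ f g, fe f ≠ fe g → EdgeClose G (fe f) (fe g) → D.Adj f g)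
    (kb : Fin 4 → ℕ) (fb : α → ℕ) (hkb : ∀ i, kb i + outs G A E (ke i) ≤ 22)
    (hfb : ∀ f, fb f + outs G A E (fe f) ≤ 22)
    (h : ∀ (L : α → Finset ℕ) (M : Fin 4 → Finset ℕ), (∀ f, fb f ≤ #(L f)) → (∀ i, kb i ≤ #(M i)) →
      Good D univ L M) : False := by
  apply reduce0 H E hE hne
  intro M hM
  obtain ⟨c, k, h1, h2, h3, h4, h5⟩ := h (fun f => M (fe f)) (fun i => M (ke i))
    (fun f => by have := hM _ (hfe f); have := hfb f; omega)
    (fun i => by have := hM _ (hke i); have := hkb i; omega)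
  have ex : ∀ e : Sym2 V, ∃ t : ℕ, e ∈ E → (∃ i, e = ke i ∧ t = k i) ∨ ∃ f, e = fe f ∧ t = c f := by
    intro e
    by_cases he : e ∈ E
    · rcases hcov e he with ⟨i, hi⟩ | ⟨f, hf⟩
      · exact ⟨k i, fun _ => Or.inl ⟨i, hi, rfl⟩⟩
      · exact ⟨c f, fun _ => Or.inr ⟨f, hf, rfl⟩⟩
    · exact ⟨0, fun h => absurd h he⟩
  choose d hd using ex
  refine ⟨d, ?_, ?_⟩
  · intro e he
    rcases hd e he with ⟨i, hi, hh⟩ | ⟨f, hf, hh⟩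
    · rw [hh, hi]; exact h3 i
    · rw [hh, hf]; exact h1 f (mem_univ _)
  · intro e he e' he' hne hcl
    rcases hd e he with ⟨i, hi, hh⟩ | ⟨f, hf, hh⟩ <;> rcases hd e' he' with ⟨i', hi', hh'⟩ | ⟨f', hf', hh'⟩
    · rw [hh, hh']
      intro hk
      exact hne (by rw [hi, hi', h4 hk])
    · rw [hh, hh']
      exact h5 i f' (mem_univ _)
    · rw [hh, hh']
      exact (h5 i' f (mem_univ _)).symm
    · rw [hh, hh']
      exact h2 f (mem_univ _) f' (mem_univ _) (hD f f' (by rw [← hf, ← hf']; exact hne)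
        (by rw [← hf, ← hf']; exact hcl))

/-- counting bound -/
lemma outs_le (H : MinBad G L A) (E : Finset (Sym2 V)) (x y : V) (he : s(x, y) ∈ E) :
    outs G A E s(x, y) ≤ ∑ p ∈ (G.neighborFinset x).erase y ∪ (G.neighborFinset y).erase x, oo A E p := by
  unfold outs oo
  refine le_trans (card_le_card ?_) card_biUnion_le
  intro e' he'
  rw [mem_filter] at he'
  obtain ⟨he'A, hcl⟩ := he'
  have hne : e' ≠ s(x, y) := fun h => (mem_sdiff.1 he'A).2 (h ▸ he)
  have hed := H.hA e' (mem_sdiff.1 he'A).1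
  rw [mem_biUnion]
  suffices ∃ p, p ∈ e' ∧ ((p ≠ y ∧ G.Adj x p) ∨ (p ≠ x ∧ G.Adj y p)) by
    obtain ⟨p, hp, hpp⟩ := this
    refine ⟨p, ?_, mem_filter.2 ⟨he'A, hp⟩⟩
    simpa using hpp
  have endp : ∀ z ∈ e', (z = x ∨ z = y) → ∃ p, p ∈ e' ∧ ((p ≠ y ∧ G.Adj x p) ∨ (p ≠ x ∧ G.Adj y p)) := by
    intro z hz hzz
    obtain ⟨t, rfl⟩ := Sym2.mem_iff_exists.1 hz
    rw [SimpleGraph.mem_edgeSet] at hed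
    refine ⟨t, Sym2.mem_mk_right _ _, ?_⟩
    rcases hzz with rfl | rfl
    · exact Or.inl ⟨fun h => hne (by rw [h]), hed⟩
    · exact Or.inr ⟨fun h => hne (by rw [h, Sym2.eq_swap]), hed⟩
  obtain ⟨u, w, hu, hw, huw⟩ := hcl
  rw [Sym2.mem_iff] at hu
  rcases huw with rfl | huw
  · exact endp u hw hu
  · by_cases hww : w = x ∨ w = y
    · exact endp w hw hww
    · push Not at hww
      refine ⟨w, hw, ?_⟩
      rcases hu with rfl | rfl
      · exact Or.inl ⟨hww.2, huw⟩
      · exact Or.inr ⟨hww.1, huw⟩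

lemma outs_le' (H : MinBad G L A) (E : Finset (Sym2 V)) (x y : V) (he : s(x, y) ∈ E) :
    outs G A E s(x, y) ≤ ∑ p ∈ (G.neighborFinset x).erase y, oo A E p +
      ∑ p ∈ (G.neighborFinset y).erase x, oo A E p := by
  refine (outs_le H E x y he).trans ?_
  rw [← sum_union_inter]
  exact Nat.le_add_right _ _

/-- `oo` is bounded by the number of neighbours along free edges -/
lemma oo_le (H : MinBad G L A) (E : Finset (Sym2 V)) (p : V) (S : Finset V)
    (hS : ∀ w ∈ S, G.Adj p w ∧ (s(p, w) ∈ A → s(p, w) ∈ E)) : oo A E p + #S ≤ 4 := by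
  have h1 : oo A E p ≤ #(G.neighborFinset p \ S) := by
    unfold oo
    refine (card_le_card ?_).trans (card_image_le (f := fun w => s(p, w)) (s := G.neighborFinset p \ S))
    intro e he
    rw [mem_filter, mem_sdiff] at he
    obtain ⟨⟨heA, heE⟩, hp⟩ := he
    obtain ⟨t, rfl⟩ := Sym2.mem_iff_exists.1 hp
    refine mem_image.2 ⟨t, mem_sdiff.2 ⟨?_, fun ht => heE ((hS t ht).2 heA)⟩, rfl⟩
    simpa using H.hA _ heA
  have h2 : S ⊆ G.neighborFinset p := fun w hw => by simpa using (hS w hw).1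
  have h3 := card_sdiff_add_card_eq_card h2
  have h4 : #(G.neighborFinset p) ≤ 4 := H.hΔ p
  omega

lemma oo_le4 (H : MinBad G L A) (E : Finset (Sym2 V)) (p : V) : oo A E p ≤ 4 := by
  simpa using oo_le H E p ∅ (by simp)

lemma sum_le_of_sub {β : Type*} [DecidableEq β] (S : Finset β) (f : β → ℕ) (k n : ℕ) (h : ∀ x ∈ S, f x ≤ k)
    (hS : #S ≤ n) : ∑ x ∈ S, f x ≤ n * k := by
  refine (sum_le_card_nsmul S f k h).trans ?_
  simpa using Nat.mul_le_mul_right k hS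

lemma ge22 (H : MinBad G L A) (x y : V) (he : s(x, y) ∈ A) :
    22 ≤ ∑ p ∈ (G.neighborFinset x).erase y ∪ (G.neighborFinset y).erase x, oo A {s(x, y)} p := by
  refine le_trans ?_ (outs_le H _ x y (mem_singleton_self _))
  by_contra hlt
  push Not at hlt
  apply reduce0 H {s(x, y)} (by simpa using H.hA _ he) ⟨_, mem_singleton_self _, he⟩
  intro M hM
  have := hM _ (mem_singleton_self _)
  obtain ⟨t, ht⟩ : (M s(x, y)).Nonempty := card_pos.1 (by omega)
  refine ⟨fun _ => t, ?_, ?_⟩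
  · intro e he
    rw [mem_singleton] at he
    rw [he]; exact ht
  · intro e he e' he' hne
    rw [mem_singleton] at he he'
    exact absurd (he.trans he'.symm) hne

def TT {V : Type*} (A : Finset (Sym2 V)) (v : V) : Prop := ∃ w, s(v, w) ∈ A

lemma nb_card (H : MinBad G L A) (x y : V) (h : G.Adj x y) :
    #((G.neighborFinset x).erase y) ≤ 3 := by
  have h1 : #(G.neighborFinset x) ≤ 4 := H.hΔ x
  have h2 := card_erase_add_one (show y ∈ G.neighborFinset x by simpa using h)
  omega

lemma TT_adj (H : MinBad G L A) (v p : V) (hv : TT A v) (hp : G.Adj v p) : TT A p := by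
  obtain ⟨w, hw⟩ := hv
  by_cases hpw : p = w
  · exact ⟨v, by rw [hpw, Sym2.eq_swap]; exact hw⟩
  by_contra hT
  have h0 : oo A {s(v, w)} p = 0 := by
    unfold oo
    rw [card_eq_zero, filter_eq_empty_iff]
    intro e he hpe
    obtain ⟨t, rfl⟩ := Sym2.mem_iff_exists.1 hpe
    exact hT ⟨t, (mem_sdiff.1 he).1⟩
  have h22 := ge22 H v w hw
  have hadj : G.Adj v w := by simpa using H.hA _ hw
  set P := (G.neighborFinset v).erase w ∪ (G.neighborFinset w).erase v with hP
  have hpP : p ∈ P := by simp [hP, hpw, hp]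
  have hPc : #P ≤ 6 := (card_union_le _ _).trans
    (Nat.add_le_add (nb_card H v w hadj) (nb_card H w v hadj.symm))
  rw [← add_sum_erase _ _ hpP, h0] at h22
  have := card_erase_add_one hpP
  have := sum_le_of_sub (P.erase p) (oo A {s(v, w)}) 4 5 (fun x _ => oo_le4 H _ x) (by omega)
  omega

lemma TT_deg (H : MinBad G L A) (v : V) (hv : TT A v) : G.degree v = 4 := by
  by_contra hd
  have hd3 : #(G.neighborFinset v) ≤ 3 := by
    have := H.hΔ v
    have h2 : #(G.neighborFinset v) = G.degree v := rfl
    omega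
  obtain ⟨w, hw⟩ := hv
  have hadj : G.Adj v w := by simpa using H.hA _ hw
  have h22 := ge22 H v w hw
  have h2 := card_erase_add_one (show w ∈ G.neighborFinset v by simpa using hadj)
  have hPc : #((G.neighborFinset v).erase w ∪ (G.neighborFinset w).erase v) ≤ 5 :=
    (card_union_le _ _).trans
      (Nat.add_le_add (by omega : _ ≤ 2) (nb_card H w v hadj.symm))
  have := sum_le_of_sub _ (oo A {s(v, w)}) 4 5 (fun x _ => oo_le4 H _ x) hPc
  omega

lemma tri_edge (H : MinBad G L A) (u v w : V) (h1 : G.Adj u v) (h2 : G.Adj v w) (h3 : G.Adj u w) :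
    s(u, v) ∉ A := by
  intro hw
  have h22 := ge22 H u v hw
  have hPc : #((G.neighborFinset u).erase v ∪ (G.neighborFinset v).erase u) ≤ 5 := by
    have a := nb_card H u v h1
    have b := nb_card H v u h1.symm
    have c := card_union_add_card_inter ((G.neighborFinset u).erase v) ((G.neighborFinset v).erase u)
    have : 0 < #((G.neighborFinset u).erase v ∩ (G.neighborFinset v).erase u) :=
      card_pos.2 ⟨w, by simp [h2, h3, h3.ne']⟩
    omega
  have := sum_le_of_sub _ (oo A {s(u, v)}) 4 5 (fun x _ => oo_le4 H _ x) hPc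
  omega

lemma no_tri (H : MinBad G L A) (u v w : V) (hu : TT A u) (h1 : G.Adj u v) (h2 : G.Adj v w)
    (h3 : G.Adj u w) : False := by
  have e1 := tri_edge H u v w h1 h2 h3
  have e2 := tri_edge H v w u h2 h3.symm h1.symm
  have e3 := tri_edge H u w v h3 h2.symm h1
  obtain ⟨z, hz⟩ := hu
  have hzv : v ≠ z := fun h => e1 (h ▸ hz)
  have hzw : w ≠ z := fun h => e3 (h ▸ hz)
  have hadj : G.Adj u z := by simpa using H.hA _ hz
  have h22 := ge22 H u z hz
  set P := (G.neighborFinset u).erase z ∪ (G.neighborFinset z).erase u with hP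
  have hPc : #P ≤ 6 := (card_union_le _ _).trans
    (Nat.add_le_add (nb_card H u z hadj) (nb_card H z u hadj.symm))
  have hvP : v ∈ P := by simp [hP, hzv, h1]
  have hwP : w ∈ P.erase v := by simp [hP, hzw, h3, h2.ne']
  rw [← add_sum_erase _ _ hvP, ← add_sum_erase _ _ hwP] at h22
  have c1 := card_erase_add_one hvP
  have c2 := card_erase_add_one hwP
  have := sum_le_of_sub ((P.erase v).erase w) (oo A {s(u, z)}) 4 4 (fun x _ => oo_le4 H _ x) (by omega)
  have o1 := oo_le H {s(u, z)} v {u, w} (by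
    intro t ht
    simp only [mem_insert, mem_singleton] at ht
    rcases ht with rfl | rfl
    · exact ⟨h1.symm, fun h => absurd (by rw [Sym2.eq_swap]; exact h) e1⟩
    · exact ⟨h2, fun h => absurd h e2⟩)
  have o2 := oo_le H {s(u, z)} w {u, v} (by
    intro t ht
    simp only [mem_insert, mem_singleton] at ht
    rcases ht with rfl | rfl
    · exact ⟨h3.symm, fun h => absurd (by rw [Sym2.eq_swap]; exact h) e3⟩
    · exact ⟨h2.symm, fun h => absurd (by rw [Sym2.eq_swap]; exact h) e2⟩)
  rw [card_pair h3.ne] at o1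
  rw [card_pair h1.ne] at o2
  omega

end
end SEC

namespace SEC
open Finset
section
variable {V : Type*} [Fintype V] [DecidableEq V] {G : SimpleGraph V} [DecidableRel G.Adj]
  {L : Sym2 V → Finset ℕ} {A : Finset (Sym2 V)}

/-- edges touching a vertex family -/
def touch {ι : Type*} [Fintype ι] (G : SimpleGraph V) [DecidableRel G.Adj] (p : ι → V) :
    Finset (Sym2 V) :=
  {e ∈ G.edgeFinset | ∃ i, p i ∈ e}

lemma mem_touch {ι : Type*} [Fintype ι] (p : ι → V) (i : ι) (w : V) (h : G.Adj (p i) w) :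
    s(p i, w) ∈ touch G p := by
  unfold touch
  rw [mem_filter]
  exact ⟨by simpa using h, i, by simp⟩

lemma mem_touch' {ι : Type*} [Fintype ι] (p : ι → V) (i : ι) (w : V) (h : G.Adj w (p i)) :
    s(w, p i) ∈ touch G p := by
  rw [Sym2.eq_swap]
  exact mem_touch p i w h.symm

lemma touch_edge {ι : Type*} [Fintype ι] (p : ι → V) : ∀ e ∈ touch G p, e ∈ G.edgeSet := by
  intro e he
  unfold touch at he
  rw [mem_filter] at he
  simpa using he.1

lemma touch_cov {ι : Type*} [Fintype ι] (p : ι → V) : ∀ e ∈ touch G p, ∃ i w, G.Adj (p i) w ∧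
    e = s(p i, w) := by
  intro e he
  have h1 := touch_edge p e he
  unfold touch at he
  rw [mem_filter] at he
  obtain ⟨-, i, hi⟩ := he
  obtain ⟨t, rfl⟩ := Sym2.mem_iff_exists.1 hi
  exact ⟨i, t, by simpa using h1, rfl⟩

lemma touch_A {ι : Type*} [Fintype ι] (H : MinBad G L A) (p : ι → V) (i : ι) (h : TT A (p i)) :
    ∃ e ∈ touch G p, e ∈ A := by
  obtain ⟨w, hw⟩ := h
  exact ⟨_, mem_touch p i w (by simpa using H.hA _ hw), hw⟩

lemma oo_touch0 {ι : Type*} [Fintype ι] (H : MinBad G L A) (p : ι → V) (i : ι) :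
    oo A (touch G p) (p i) = 0 := by
  unfold oo
  rw [card_eq_zero, filter_eq_empty_iff]
  intro e he hpe
  obtain ⟨t, rfl⟩ := Sym2.mem_iff_exists.1 hpe
  exact (mem_sdiff.1 he).2 (mem_touch p i t (by simpa using H.hA _ (mem_sdiff.1 he).1))

lemma oo_touch3 {ι : Type*} [Fintype ι] (H : MinBad G L A) (p : ι → V) (i : ι) (y : V)
    (h : G.Adj (p i) y) : oo A (touch G p) y ≤ 3 := by
  have := oo_le H (touch G p) y {p i} (by
    intro w hw
    rw [mem_singleton] at hw
    subst hw
    exact ⟨h.symm, fun _ => mem_touch' p i y h.symm⟩)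
  simp at this
  omega

lemma oo_touch2 {ι : Type*} [Fintype ι] (H : MinBad G L A) (p : ι → V) (i k : ι) (y : V)
    (hik : p i ≠ p k)
    (h : G.Adj (p i) y) (h' : G.Adj (p k) y) : oo A (touch G p) y ≤ 2 := by
  have := oo_le H (touch G p) y {p i, p k} (by
    intro w hw
    rw [mem_insert, mem_singleton] at hw
    rcases hw with rfl | rfl
    · exact ⟨h.symm, fun _ => mem_touch' p i y h.symm⟩
    · exact ⟨h'.symm, fun _ => mem_touch' p k y h'.symm⟩)
  rw [card_pair hik] at this
  omega

structure C4 (G : SimpleGraph V) (p : Fin 4 → V) (y : Fin 4 → Fin 2 → V) : Prop where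
  hN : ∀ i w, G.Adj (p i) w ↔ w = p (i + 1) ∨ w = p (i + 3) ∨ w = y i 0 ∨ w = y i 1
  hy : ∀ i, y i 0 ≠ y i 1
  hyp : ∀ i j k, y i j ≠ p k
  hp : ∀ i k, i ≠ k → p i ≠ p k

lemma C4.adj {p : Fin 4 → V} {y : Fin 4 → Fin 2 → V} (h : C4 G p y) (i : Fin 4) (j : Fin 2) :
    G.Adj (p i) (y i j) := by
  rw [h.hN]
  fin_cases j <;> simp

def C4D (G : SimpleGraph V) (p : Fin 4 → V) (y : Fin 4 → Fin 2 → V) :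
    SimpleGraph (Fin 4 × Fin 2) where
  Adj f g := f ≠ g ∧ EdgeClose G s(p f.1, y f.1 f.2) s(p g.1, y g.1 g.2)
  symm := ⟨fun _ _ h => ⟨h.1.symm, EdgeClose.symm h.2⟩⟩
  loopless := ⟨fun _ h => h.1 rfl⟩

lemma C4.nadj {p : Fin 4 → V} {y : Fin 4 → Fin 2 → V} (h : C4 G p y) (i k : Fin 4) (j l : Fin 2)
    (hik : k = i + 2) (hns : ∀ j l, y i j ≠ y k l) (hn : ¬ G.Adj (y i j) (y k l)) :
    ¬ (C4D G p y).Adj (i, j) (k, l) := by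
  rintro ⟨-, u, w, hu, hw, huw⟩
  simp only [Sym2.mem_iff] at hu hw
  have e1 : i ≠ k := by subst hik; fin_cases i <;> simp
  have e2 : ∀ w, G.Adj (p i) w → (∃ t, w = y k t) ∨ w = p k → False := by
    intro w hw hww
    rw [h.hN] at hw
    rcases hww with ⟨t, rfl⟩ | rfl
    · rcases hw with hw | hw | hw | hw
      · exact h.hyp _ _ _ hw
      · exact h.hyp _ _ _ hw
      · exact hns _ _ hw.symm
      · exact hns _ _ hw.symm
    · rcases hw with hw | hw | hw | hw
      · refine h.hp _ _ ?_ hw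
        subst hik; fin_cases i <;> simp
      · refine h.hp _ _ ?_ hw
        subst hik; fin_cases i <;> simp
      · exact h.hyp _ _ _ hw.symm
      · exact h.hyp _ _ _ hw.symm
  have e3 : ∀ w, G.Adj (p k) w → (∃ t, w = y i t) → False := by
    intro w hw hww
    rw [h.hN] at hw
    obtain ⟨t, rfl⟩ := hww
    rcases hw with hw | hw | hw | hw
    · exact h.hyp _ _ _ hw
    · exact h.hyp _ _ _ hw
    · exact hns _ _ hw
    · exact hns _ _ hw
  rcases hu with rfl | rfl <;> rcases hw with rfl | rfl <;> rcases huw with huw | huw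
  · exact h.hp _ _ e1 huw
  · exact e2 _ huw (Or.inr rfl)
  · exact h.hyp _ _ _ huw.symm
  · exact e2 _ huw (Or.inl ⟨_, rfl⟩)
  · exact h.hyp _ _ _ huw
  · exact e3 _ huw.symm ⟨_, rfl⟩
  · exact hns _ _ huw
  · exact hn huw

lemma sum3 (S : Finset V) (a b c : V) (f : V → ℕ) (h : ∀ x ∈ S, x = a ∨ x = b ∨ x = c) :
    ∑ x ∈ S, f x ≤ f a + f b + f c := by
  have : S ⊆ {a, b, c} := fun x hx => by simpa using h x hx
  refine (sum_le_sum_of_subset this).trans ?_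
  refine (sum_insert_le' a {b, c} f).trans ?_
  have := sum_insert_le' b {c} f
  simp at this
  omega
where
  sum_insert_le' (a : V) (S : Finset V) (f : V → ℕ) : ∑ x ∈ insert a S, f x ≤ f a + ∑ x ∈ S, f x := by
    by_cases h : a ∈ S
    · rw [insert_eq_of_mem h]; exact Nat.le_add_left _ _
    · rw [sum_insert h]

lemma C4.outs_ke (H : MinBad G L A) {p : Fin 4 → V} {y : Fin 4 → Fin 2 → V} (h : C4 G p y)
    (i : Fin 4) : outs G A (touch G p) s(p i, p (i + 1)) ≤
      (oo A (touch G p) (y i 0) + oo A (touch G p) (y i 1)) +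
      (oo A (touch G p) (y (i + 1) 0) + oo A (touch G p) (y (i + 1) 1)) := by
  have hadj : G.Adj (p i) (p (i + 1)) := (h.hN _ _).2 (Or.inl rfl)
  refine (outs_le' H _ _ _ (mem_touch p i _ hadj)).trans ?_
  have h1 := sum3 ((G.neighborFinset (p i)).erase (p (i + 1))) (p (i + 3)) (y i 0) (y i 1)
    (oo A (touch G p)) (by
      intro x hx
      simp only [mem_erase, SimpleGraph.mem_neighborFinset, h.hN] at hx
      tauto)
  have h2 := sum3 ((G.neighborFinset (p (i + 1))).erase (p i)) (p (i + 1 + 1)) (y (i + 1) 0)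
    (y (i + 1) 1) (oo A (touch G p)) (by
      intro x hx
      have : i + 1 + 3 = i := by fin_cases i <;> rfl
      simp only [mem_erase, SimpleGraph.mem_neighborFinset, h.hN, this] at hx
      tauto)
  rw [oo_touch0 H] at h1 h2
  omega

lemma C4.outs_fe (H : MinBad G L A) {p : Fin 4 → V} {y : Fin 4 → Fin 2 → V} (h : C4 G p y)
    (i : Fin 4) (j : Fin 2) : outs G A (touch G p) s(p i, y i j) ≤
      3 + ∑ z ∈ (G.neighborFinset (y i j)).erase (p i), oo A (touch G p) z := by
  have hadj : G.Adj (p i) (y i j) := h.adj i j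
  refine (outs_le' H _ _ _ (mem_touch p i _ hadj)).trans ?_
  have h1 := sum3 ((G.neighborFinset (p i)).erase (y i j)) (p (i + 1)) (p (i + 3)) (y i (j + 1))
    (oo A (touch G p)) (by
      intro x hx
      simp only [mem_erase, SimpleGraph.mem_neighborFinset, h.hN] at hx
      fin_cases j <;> simp at hx ⊢ <;> tauto)
  rw [oo_touch0 H, oo_touch0 H] at h1
  have := oo_touch3 H p i _ (h.adj i (j + 1))
  omega

lemma C4.outs_fe15 (H : MinBad G L A) {p : Fin 4 → V} {y : Fin 4 → Fin 2 → V} (h : C4 G p y)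
    (i : Fin 4) (j : Fin 2) : outs G A (touch G p) s(p i, y i j) ≤ 15 := by
  have h1 := h.outs_fe H i j
  have h2 := sum_le_of_sub ((G.neighborFinset (y i j)).erase (p i)) (oo A (touch G p)) 4 3
    (fun x _ => oo_le4 H _ x) (nb_card H _ _ (h.adj i j).symm)
  omega

lemma C4.outs_fe11 (H : MinBad G L A) {p : Fin 4 → V} {y : Fin 4 → Fin 2 → V} (h : C4 G p y)
    (i k : Fin 4) (j l : Fin 2) (hik : i ≠ k) (hs : y i j = y k l) :
    outs G A (touch G p) s(p i, y i j) ≤ 11 := by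
  have h1 := h.outs_fe H i j
  have hk : p k ∈ (G.neighborFinset (y i j)).erase (p i) := by
    rw [mem_erase, SimpleGraph.mem_neighborFinset, hs]
    exact ⟨h.hp _ _ hik.symm, (h.adj k l).symm⟩
  rw [← add_sum_erase _ _ hk, oo_touch0 H] at h1
  have h3 := card_erase_add_one hk
  have h4 := nb_card H _ _ (h.adj i j).symm
  have h2 := sum_le_of_sub (((G.neighborFinset (y i j)).erase (p i)).erase (p k))
    (oo A (touch G p)) 4 2 (fun x _ => oo_le4 H _ x) (by omega)
  omega

lemma C4.run (H : MinBad G L A) {p : Fin 4 → V} {y : Fin 4 → Fin 2 → V} (h : C4 G p y)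
    (hT : TT A (p 0)) (kb : ℕ) (fb : Fin 4 × Fin 2 → ℕ)
    (hkb : ∀ i, kb + outs G A (touch G p) s(p i, p (i + 1)) ≤ 22)
    (hfb : ∀ f : Fin 4 × Fin 2, fb f + outs G A (touch G p) s(p f.1, y f.1 f.2) ≤ 22)
    (hg : ∀ (L : Fin 4 × Fin 2 → Finset ℕ) (M : Fin 4 → Finset ℕ), (∀ f, fb f ≤ #(L f)) →
      (∀ i, kb ≤ #(M i)) → Good (C4D G p y) univ L M) : False := by
  refine reduce H (touch G p) (touch_edge p) (touch_A H p 0 hT) (fun i => s(p i, p (i + 1)))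
    (fun f : Fin 4 × Fin 2 => s(p f.1, y f.1 f.2)) ?_ ?_ ?_ (C4D G p y) ?_ (fun _ => kb) fb hkb hfb hg
  · intro i
    exact mem_touch p i _ ((h.hN _ _).2 (Or.inl rfl))
  · intro f
    exact mem_touch p f.1 _ (h.adj _ _)
  · intro e he
    obtain ⟨i, w, hw, rfl⟩ := touch_cov p e he
    rw [h.hN] at hw
    rcases hw with rfl | rfl | rfl | rfl
    · exact Or.inl ⟨i, rfl⟩
    · refine Or.inl ⟨i + 3, ?_⟩
      have : i + 3 + 1 = i := by fin_cases i <;> rfl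
      rw [this, Sym2.eq_swap]
    · exact Or.inr ⟨(i, 0), rfl⟩
    · exact Or.inr ⟨(i, 1), rfl⟩
  · intro f g hne hcl
    exact ⟨fun e => hne (by rw [e]), hcl⟩

def A2 (A : Finset (Sym2 V)) (G : SimpleGraph V) [DecidableRel G.Adj] (p : Fin 4 → V) (y : Fin 4 → Fin 2 → V) (i : Fin 4) : ℕ :=
  oo A (touch G p) (y i 0) + oo A (touch G p) (y i 1)

lemma C4.A6 (H : MinBad G L A) {p : Fin 4 → V} {y : Fin 4 → Fin 2 → V} (h : C4 G p y) (i : Fin 4) :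
    A2 A G p y i ≤ 6 := by
  have h1 := oo_touch3 H p i _ (h.adj i 0)
  have h2 := oo_touch3 H p i _ (h.adj i 1)
  unfold A2
  omega

lemma C4.A5 (H : MinBad G L A) {p : Fin 4 → V} {y : Fin 4 → Fin 2 → V} (h : C4 G p y) (i k : Fin 4)
    (j l : Fin 2) (hik : i ≠ k) (hs : y i j = y k l) : A2 A G p y i ≤ 5 := by
  have h1 := oo_touch3 H p i _ (h.adj i 0)
  have h2 := oo_touch3 H p i _ (h.adj i 1)
  have h3 := oo_touch2 H p i k (y i j) (h.hp _ _ hik) (h.adj i j) (by rw [hs]; exact h.adj k l)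
  unfold A2
  fin_cases j
  · change oo A (touch G p) (y i 0) ≤ 2 at h3
    omega
  · change oo A (touch G p) (y i 1) ≤ 2 at h3
    omega

lemma C4.kb (H : MinBad G L A) {p : Fin 4 → V} {y : Fin 4 → Fin 2 → V} (h : C4 G p y) (s t : ℕ)
    (h0 : A2 A G p y 0 ≤ s) (h2 : A2 A G p y 2 ≤ s) (h1 : A2 A G p y 1 ≤ t) (h3 : A2 A G p y 3 ≤ t)
    (i : Fin 4) : outs G A (touch G p) s(p i, p (i + 1)) ≤ s + t := by
  refine (h.outs_ke H i).trans ?_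
  change A2 A G p y i + A2 A G p y (i + 1) ≤ s + t
  fin_cases i
  · change A2 A G p y 0 + A2 A G p y 1 ≤ s + t
    omega
  · change A2 A G p y 1 + A2 A G p y 2 ≤ s + t
    omega
  · change A2 A G p y 2 + A2 A G p y 3 ≤ s + t
    omega
  · change A2 A G p y 3 + A2 A G p y 0 ≤ s + t
    omega

lemma C4.ca (H : MinBad G L A) {p : Fin 4 → V} {y : Fin 4 → Fin 2 → V} (h : C4 G p y)
    (hT : TT A (p 0)) (j l j' l' : Fin 2) (h02 : y 0 j = y 2 l) (h13 : y 1 j' = y 3 l') : False := by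
  refine h.run H hT 12 (fun f => if f = (0, j) then 8 else 7) ?_ ?_ ?_
  · intro i
    have := h.kb H 5 5 (h.A5 H 0 2 j l (by decide) h02) (h.A5 H 2 0 l j (by decide) h02.symm)
      (h.A5 H 1 3 j' l' (by decide) h13) (h.A5 H 3 1 l' j' (by decide) h13.symm) i
    omega
  · intro f
    split_ifs with hf
    · subst hf
      have := h.outs_fe11 H 0 2 j l (by decide) h02
      simp only
      omega
    · have := h.outs_fe15 H f.1 f.2
      omega
  · intro L M hL hM
    refine c4_zero _ L M univ (by simp) hM (fun f _ => ?_) (0, j) (mem_univ _) ?_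
    · have := hL f
      split_ifs at this <;> omega
    · simpa using hL (0, j)

lemma C4.cb (H : MinBad G L A) {p : Fin 4 → V} {y : Fin 4 → Fin 2 → V} (h : C4 G p y)
    (hT : TT A (p 0)) (j l j' l' : Fin 2) (h02 : y 0 j = y 2 l) : y 1 j' ≠ y 3 l' ∧
      G.Adj (y 1 j') (y 3 l') := by
  refine ⟨fun e => h.ca H hT j l j' l' h02 e, ?_⟩
  by_contra hn
  have hna := h.nadj 1 3 j' l' (by decide) (fun a b e => h.ca H hT j l a b h02 e) hn
  refine h.run H hT 11 (fun f => 7) ?_ ?_ ?_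
  · intro i
    have := h.kb H 5 6 (h.A5 H 0 2 j l (by decide) h02) (h.A5 H 2 0 l j (by decide) h02.symm)
      (h.A6 H 1) (h.A6 H 3) i
    omega
  · intro f
    have := h.outs_fe15 H f.1 f.2
    omega
  · intro L M hL hM
    exact c4_one _ L M univ (by simp) hM (fun f _ => hL f) (1, j') (3, l') (mem_univ _) (mem_univ _)
      (by simp) hna

lemma C4.cc (H : MinBad G L A) {p : Fin 4 → V} {y : Fin 4 → Fin 2 → V} (h : C4 G p y)
    (hT : TT A (p 0)) (h02 : ∀ j l, y 0 j ≠ y 2 l) (h13 : ∀ j l, y 1 j ≠ y 3 l)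
    (j l j' l' : Fin 2) (hn : ¬ G.Adj (y 0 j) (y 2 l)) (hn' : ¬ G.Adj (y 1 j') (y 3 l')) : False := by
  have hna := h.nadj 0 2 j l (by decide) h02 hn
  have hna' := h.nadj 1 3 j' l' (by decide) h13 hn'
  refine h.run H hT 10 (fun f => 7) ?_ ?_ ?_
  · intro i
    have := h.kb H 6 6 (h.A6 H 0) (h.A6 H 2) (h.A6 H 1) (h.A6 H 3) i
    omega
  · intro f
    have := h.outs_fe15 H f.1 f.2
    omega
  · intro L M hL hM
    exact c4_two _ L M univ (by simp) hM (fun f _ => hL f) (0, j) (2, l) (1, j') (3, l') (mem_univ _)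
      (mem_univ _) (mem_univ _) (mem_univ _)
      (by simp) hna (by simp) hna' (by simp) (by simp) (by simp) (by simp)

end
end SEC

namespace SEC
open Finset
section
variable {V : Type*} [Fintype V] [DecidableEq V] {G : SimpleGraph V} [DecidableRel G.Adj]
  {L : Sym2 V → Finset ℕ} {A : Finset (Sym2 V)}

lemma mkC4 (H : MinBad G L A) (p : Fin 4 → V) (hT : TT A (p 0)) (hadj : ∀ i, G.Adj (p i) (p (i + 1)))
    (h02 : p 0 ≠ p 2) (h13 : p 1 ≠ p 3) : ∃ y, C4 G p y := by
  have a0 : G.Adj (p 0) (p 1) := hadj 0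
  have a1 : G.Adj (p 1) (p 2) := hadj 1
  have a2 : G.Adj (p 2) (p 3) := hadj 2
  have a3 : G.Adj (p 3) (p 0) := hadj 3
  have t1 := TT_adj H _ _ hT a0
  have t2 := TT_adj H _ _ t1 a1
  have t3 := TT_adj H _ _ t2 a2
  have hTT : ∀ i, TT A (p i) := by intro i; fin_cases i <;> assumption
  have hp : ∀ i k, i ≠ k → p i ≠ p k := by
    intro i k hik
    fin_cases i <;> fin_cases k <;>
    first
    | exact absurd rfl hik
    | exact a0.ne
    | exact a0.ne'
    | exact a1.ne
    | exact a1.ne'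
    | exact a2.ne
    | exact a2.ne'
    | exact a3.ne
    | exact a3.ne'
    | exact h02
    | exact h02.symm
    | exact h13
    | exact h13.symm
  have h31 : ∀ i : Fin 4, i + 3 + 1 = i := by decide
  have ex : ∀ i, ∃ y : Fin 2 → V, y 0 ≠ y 1 ∧
      ((G.neighborFinset (p i)).erase (p (i + 1))).erase (p (i + 3)) = {y 0, y 1} := by
    intro i
    have hd : #(G.neighborFinset (p i)) = 4 := TT_deg H _ (hTT i)
    have m1 : p (i + 1) ∈ G.neighborFinset (p i) := by simpa using hadj i
    have m2 : p (i + 3) ∈ (G.neighborFinset (p i)).erase (p (i + 1)) := by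
      rw [mem_erase, SimpleGraph.mem_neighborFinset]
      refine ⟨hp _ _ ?_, ?_⟩
      · clear m1 hd; revert i; decide
      · have := hadj (i + 3)
        rw [h31] at this
        exact this.symm
    have c1 := card_erase_add_one m1
    have c2 := card_erase_add_one m2
    obtain ⟨a, b, hab, he⟩ := card_eq_two.1 (show #(((G.neighborFinset (p i)).erase
      (p (i + 1))).erase (p (i + 3))) = 2 by omega)
    exact ⟨![a, b], hab, he⟩
  choose y hy1 hy2 using ex
  have hN : ∀ i w, G.Adj (p i) w ↔ w = p (i + 1) ∨ w = p (i + 3) ∨ w = y i 0 ∨ w = y i 1 := by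
    intro i w
    have hw : w ∈ ((G.neighborFinset (p i)).erase (p (i + 1))).erase (p (i + 3)) ↔ w ∈ ({y i 0, y i 1} : Finset V) := by
      rw [hy2]
    simp only [mem_erase, SimpleGraph.mem_neighborFinset, mem_insert, mem_singleton] at hw
    have b1 := hadj i
    have b2 := hadj (i + 3)
    rw [h31] at b2
    constructor
    · intro h
      tauto
    · rintro (rfl | rfl | h | h)
      · exact b1
      · exact b2.symm
      · exact (hw.2 (Or.inl h)).2.2
      · exact (hw.2 (Or.inr h)).2.2
  refine ⟨y, hN, hy1, ?_, hp⟩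
  intro i j k hk
  have hw : y i j ∈ ((G.neighborFinset (p i)).erase (p (i + 1))).erase (p (i + 3)) := by
    rw [hy2]
    fin_cases j <;> simp
  simp only [mem_erase, SimpleGraph.mem_neighborFinset, hk] at hw
  have hkk : k = i ∨ k = i + 1 ∨ k = i + 3 ∨ k = i + 2 := by
    clear hw hk
    revert i k; decide
  rcases hkk with rfl | rfl | rfl | rfl
  · exact hw.2.2.ne rfl
  · exact hw.2.1 rfl
  · exact hw.1 rfl
  · have b1 := hadj i
    have b2 := hadj (i + 1)
    have : i + 1 + 1 = i + 2 := by clear hw hk b1 b2; revert i; decide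
    rw [this] at b2
    exact no_tri H _ _ _ (hTT i) b1 b2 hw.2.2

lemma C4.pend {p : Fin 4 → V} {y : Fin 4 → Fin 2 → V} (h : C4 G p y) (i : Fin 4) (w : V)
    (hw : G.Adj (p i) w) (h1 : w ≠ p (i + 1)) (h3 : w ≠ p (i + 3)) : ∃ j, w = y i j := by
  rw [h.hN] at hw
  rcases hw with hw | hw | hw | hw
  · exact absurd hw h1
  · exact absurd hw h3
  · exact ⟨_, hw⟩
  · exact ⟨_, hw⟩

lemma cyc (H : MinBad G L A) (u0 u1 u2 u3 : V) (hT : TT A u0) (a0 : G.Adj u0 u1) (a1 : G.Adj u1 u2)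
    (a2 : G.Adj u2 u3) (a3 : G.Adj u3 u0) (h02 : u0 ≠ u2) (h13 : u1 ≠ u3) :
    ∃ y, C4 G ![u0, u1, u2, u3] y := by
  refine mkC4 H _ hT ?_ h02 h13
  intro i
  fin_cases i <;> assumption

lemma graphB (H : MinBad G L A) (u0 u1 u2 u3 z : V) (hT : TT A u0) (a0 : G.Adj u0 u1)
    (a1 : G.Adj u1 u2)
    (a2 : G.Adj u2 u3) (a3 : G.Adj u3 u0) (h02 : u0 ≠ u2) (h13 : u1 ≠ u3)
    (z0 : G.Adj u0 z) (z2 : G.Adj u2 z) (z1 : z ≠ u1) (z3 : z ≠ u3) (a b : V)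
    (ha : G.Adj u1 a) (ha0 : a ≠ u0) (ha2 : a ≠ u2) (hb : G.Adj u3 b) (hb0 : b ≠ u0) (hb2 : b ≠ u2) :
    a ≠ b ∧ G.Adj a b := by
  obtain ⟨y, h⟩ := cyc H u0 u1 u2 u3 hT a0 a1 a2 a3 h02 h13
  obtain ⟨j, hj⟩ := h.pend 0 z z0 z1 z3
  obtain ⟨l, hl⟩ := h.pend 2 z z2 z3 z1
  obtain ⟨j', rfl⟩ := h.pend 1 a ha ha2 ha0
  obtain ⟨l', rfl⟩ := h.pend 3 b hb hb0 hb2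
  exact h.cb H hT j l j' l' (hj.symm.trans hl)

lemma graphC (H : MinBad G L A) (u0 u1 u2 u3 : V) (hT : TT A u0) (a0 : G.Adj u0 u1)
    (a1 : G.Adj u1 u2)
    (a2 : G.Adj u2 u3) (a3 : G.Adj u3 u0) (h02 : u0 ≠ u2) (h13 : u1 ≠ u3)
    (s02 : ∀ z, G.Adj u0 z → G.Adj u2 z → z ≠ u1 → z ≠ u3 → False)
    (s13 : ∀ z, G.Adj u1 z → G.Adj u3 z → z ≠ u0 → z ≠ u2 → False)
    (a b a' b' : V)
    (ha : G.Adj u0 a) (ha1 : a ≠ u1) (ha3 : a ≠ u3) (hb : G.Adj u2 b) (hb1 : b ≠ u1) (hb3 : b ≠ u3)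
    (ha' : G.Adj u1 a') (ha0 : a' ≠ u0) (ha2 : a' ≠ u2) (hb' : G.Adj u3 b') (hb0 : b' ≠ u0)
    (hb2 : b' ≠ u2) (hn : ¬ G.Adj a b) (hn' : ¬ G.Adj a' b') : False := by
  obtain ⟨y, h⟩ := cyc H u0 u1 u2 u3 hT a0 a1 a2 a3 h02 h13
  obtain ⟨j, rfl⟩ := h.pend 0 a ha ha1 ha3
  obtain ⟨l, rfl⟩ := h.pend 2 b hb hb3 hb1
  obtain ⟨j', rfl⟩ := h.pend 1 a' ha' ha2 ha0
  obtain ⟨l', rfl⟩ := h.pend 3 b' hb' hb0 hb2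
  refine h.cc H hT ?_ ?_ j l j' l' hn hn'
  · intro j l e
    exact s02 (y 0 j) (h.adj 0 j) (by rw [e]; exact h.adj 2 l) (h.hyp 0 j 1) (h.hyp 0 j 3)
  · intro j l e
    exact s13 (y 1 j) (h.adj 1 j) (by rw [e]; exact h.adj 3 l) (h.hyp 1 j 0) (h.hyp 1 j 2)

lemma two_more (H : MinBad G L A) (v a b : V) (hT : TT A v) (ha : G.Adj v a) (hb : G.Adj v b)
    (hab : a ≠ b) : ∃ c d, c ≠ d ∧ G.Adj v c ∧ G.Adj v d ∧ c ≠ a ∧ c ≠ b ∧ d ≠ a ∧ d ≠ b := by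
  have hd : #(G.neighborFinset v) = 4 := TT_deg H _ hT
  have m1 : a ∈ G.neighborFinset v := by simpa using ha
  have m2 : b ∈ (G.neighborFinset v).erase a := by simp [hb, hab.symm]
  have c1 := card_erase_add_one m1
  have c2 := card_erase_add_one m2
  obtain ⟨c, d, hcd, he⟩ := card_eq_two.1 (show #(((G.neighborFinset v).erase a).erase b) = 2 by omega)
  have hc : c ∈ ((G.neighborFinset v).erase a).erase b := by rw [he]; simp
  have hd : d ∈ ((G.neighborFinset v).erase a).erase b := by rw [he]; simp
  simp only [mem_erase, SimpleGraph.mem_neighborFinset] at hc hd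
  exact ⟨c, d, hcd, hc.2.2, hd.2.2, hc.2.1, hc.1, hd.2.1, hd.1⟩

lemma no_K23 (H : MinBad G L A) (u w v x y : V) (hT : TT A u) (huw : u ≠ w) (hvx : v ≠ x)
    (hvy : v ≠ y) (hxy : x ≠ y) (uv : G.Adj u v) (ux : G.Adj u x) (uy : G.Adj u y)
    (wv : G.Adj w v) (wx : G.Adj w x) (wy : G.Adj w y) : False := by
  have Tv := TT_adj H _ _ hT uv
  have Tx := TT_adj H _ _ hT ux
  have Ty := TT_adj H _ _ hT uy
  obtain ⟨a, -, -, va, -, au, aw, -, -⟩ := two_more H v u w Tv uv.symm wv.symm huw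
  obtain ⟨x1, x2, hx, xx1, xx2, x1u, x1w, x2u, x2w⟩ := two_more H x u w Tx ux.symm wx.symm huw
  obtain ⟨y1, y2, hy, yy1, yy2, y1u, y1w, y2u, y2w⟩ := two_more H y u w Ty uy.symm wy.symm huw
  have X1 := graphB H u v w x y hT uv wv.symm wx ux.symm huw hvx uy wy hvy.symm hxy.symm a x1
    va au aw xx1 x1u x1w
  have X2 := graphB H u v w x y hT uv wv.symm wx ux.symm huw hvx uy wy hvy.symm hxy.symm a x2
    va au aw xx2 x2u x2w
  have Y1 := graphB H u v w y x hT uv wv.symm wy uy.symm huw hvy ux wx hvx.symm hxy a y1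
    va au aw yy1 y1u y1w
  have Y2 := graphB H u v w y x hT uv wv.symm wy uy.symm huw hvy ux wx hvx.symm hxy a y2
    va au aw yy2 y2u y2w
  have D := fun s t hs h1 h2 ht h3 h4 => (graphB H u x w y v hT ux wx.symm wy uy.symm huw hxy uv wv
    hvx hvy s t hs h1 h2 ht h3 h4).1
  have d11 := D x1 y1 xx1 x1u x1w yy1 y1u y1w
  have d12 := D x1 y2 xx1 x1u x1w yy2 y2u y2w
  have d21 := D x2 y1 xx2 x2u x2w yy1 y1u y1w
  have d22 := D x2 y2 xx2 x2u x2w yy2 y2u y2w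
  have nv : ∀ s, G.Adj x s → v ≠ s := by
    rintro s hs rfl
    exact no_tri H u x v hT ux hs uv
  have nv' : ∀ s, G.Adj y s → v ≠ s := by
    rintro s hs rfl
    exact no_tri H u y v hT uy hs uv
  have hsub : ({v, x1, x2, y1, y2} : Finset V) ⊆ G.neighborFinset a := by
    intro t ht
    simp only [mem_insert, mem_singleton] at ht
    rw [SimpleGraph.mem_neighborFinset]
    rcases ht with rfl | rfl | rfl | rfl | rfl
    · exact va.symm
    · exact X1.2
    · exact X2.2
    · exact Y1.2
    · exact Y2.2
  have h1 := card_le_card hsub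
  have h2 : #(G.neighborFinset a) ≤ 4 := H.hΔ a
  rw [card_insert_of_notMem, card_insert_of_notMem, card_insert_of_notMem, card_pair hy] at h1
  · omega
  · simp [d21, d22]
  · simp [d11, d12, hx]
  · simp [nv _ xx1, nv _ xx2, nv' _ yy1, nv' _ yy2]

lemma c4_half (H : MinBad G L A) (u0 u1 u2 u3 : V) (hT : TT A u0) (a0 : G.Adj u0 u1)
    (a1 : G.Adj u1 u2)
    (a2 : G.Adj u2 u3) (a3 : G.Adj u3 u0) (h02 : u0 ≠ u2) (h13 : u1 ≠ u3)
    (hall : ∀ a b, G.Adj u0 a → a ≠ u1 → a ≠ u3 → G.Adj u2 b → b ≠ u1 → b ≠ u3 → G.Adj a b) :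
    False := by
  have t1 := TT_adj H _ _ hT a0
  have t2 := TT_adj H _ _ t1 a1
  obtain ⟨c, d, hcd, c0, d0, c1, c3, d1, d3⟩ := two_more H u0 u1 u3 hT a0 a3.symm h13
  obtain ⟨e, f, hef, e0, f0, e1, e3, f1, f3⟩ := two_more H u2 u1 u3 t2 a1.symm a2 h13
  have hne : ∀ z, G.Adj u2 z → u0 ≠ z := by
    rintro z hz rfl
    exact no_tri H u0 u1 u2 hT a0 a1 hz.symm
  exact no_K23 H c d u0 e f (TT_adj H _ _ hT c0) hcd (hne e e0) (hne f f0) hef c0.symm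
    (hall c e c0 c1 c3 e0 e1 e3) (hall c f c0 c1 c3 f0 f1 f3) d0.symm
    (hall d e d0 d1 d3 e0 e1 e3) (hall d f d0 d1 d3 f0 f1 f3)

lemma no_C4 (H : MinBad G L A) (u0 u1 u2 u3 : V) (hT : TT A u0) (a0 : G.Adj u0 u1)
    (a1 : G.Adj u1 u2)
    (a2 : G.Adj u2 u3) (a3 : G.Adj u3 u0) (h02 : u0 ≠ u2) (h13 : u1 ≠ u3) : False := by
  have t1 := TT_adj H _ _ hT a0
  refine c4_half H u0 u1 u2 u3 hT a0 a1 a2 a3 h02 h13 ?_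
  intro a b ha ha1 ha3 hb hb1 hb3
  by_contra hn
  refine c4_half H u1 u2 u3 u0 t1 a1 a2 a3 a0 h13 h02.symm ?_
  intro a' b' ha' ha2 ha0 hb' hb2 hb0
  by_contra hn'
  refine graphC H u0 u1 u2 u3 hT a0 a1 a2 a3 h02 h13 ?_ ?_ a b a' b' ha ha1 ha3 hb hb1 hb3
    ha' ha0 ha2 hb' hb0 hb2 hn hn'
  · intro z z0 z2 z1 z3
    exact no_K23 H u0 u2 u1 u3 z hT h02 h13 z1.symm z3.symm a0 a3.symm z0 a1.symm a2 z2
  · intro z z1 z3 z0 z2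
    exact no_K23 H u1 u3 u0 u2 z t1 h13 h02 z0.symm z2.symm a0.symm a1 z1 a3 a2.symm z3

end
end SEC

namespace SEC
open Finset
section
variable {V : Type*} [Fintype V] [DecidableEq V] {G : SimpleGraph V} [DecidableRel G.Adj]
  {L : Sym2 V → Finset ℕ} {A : Finset (Sym2 V)}

lemma enum (S : Finset V) (n : ℕ) (h : #S = n) : ∃ f : Fin n → V, Function.Injective f ∧
    ∀ w, w ∈ S ↔ ∃ i, w = f i := by
  refine ⟨fun i => ((S.equivFinOfCardEq h).symm i : V), ?_, ?_⟩
  · intro i j hij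
    exact (S.equivFinOfCardEq h).symm.injective (Subtype.ext hij)
  · intro w
    constructor
    · intro hw
      exact ⟨S.equivFinOfCardEq h ⟨w, hw⟩, by simp⟩
    · rintro ⟨i, rfl⟩
      exact ((S.equivFinOfCardEq h).symm i).2

structure Star (G : SimpleGraph V) (A : Finset (Sym2 V)) (v : V) (x : Fin 4 → V)
    (y : Fin 4 × Fin 3 → V) : Prop where
  Tv : TT A v
  xi : Function.Injective x
  hx : ∀ w, G.Adj v w ↔ ∃ i, w = x i
  yi : ∀ f g, f.1 = g.1 → y f = y g → f = g
  hy : ∀ i w, G.Adj (x i) w ↔ w = v ∨ ∃ j, w = y (i, j)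
  yv : ∀ f, y f ≠ v

lemma mkStar (H : MinBad G L A) (v : V) (hT : TT A v) : ∃ x y, Star G A v x y := by
  obtain ⟨x, xi, hx⟩ := enum (G.neighborFinset v) 4 (TT_deg H v hT)
  have hx' : ∀ w, G.Adj v w ↔ ∃ i, w = x i := fun w => by rw [← hx]; simp
  have hvx : ∀ i, G.Adj v (x i) := fun i => (hx' _).2 ⟨i, rfl⟩
  have ex : ∀ i, ∃ f : Fin 3 → V, Function.Injective f ∧
      ∀ w, w ∈ (G.neighborFinset (x i)).erase v ↔ ∃ j, w = f j := by
    intro i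
    apply enum
    have h1 : #(G.neighborFinset (x i)) = 4 := TT_deg H _ (TT_adj H _ _ hT (hvx i))
    have := card_erase_add_one (show v ∈ G.neighborFinset (x i) by simpa using (hvx i).symm)
    omega
  choose y yi hy using ex
  refine ⟨x, fun f => y f.1 f.2, hT, xi, hx', ?_, ?_, ?_⟩
  · rintro ⟨i, j⟩ ⟨k, l⟩ h1 h2
    simp only at h1 h2
    subst h1
    rw [yi _ h2]
  · intro i w
    have := hy i w
    simp only [mem_erase, SimpleGraph.mem_neighborFinset] at this
    have h2 := (hvx i).symm
    constructor
    · intro h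
      by_cases hwv : w = v
      · exact Or.inl hwv
      · exact Or.inr (this.1 ⟨hwv, h⟩)
    · rintro (rfl | h)
      · exact h2
      · exact (this.2 h).2
  · intro f
    have := (hy f.1 (y f.1 f.2)).2 ⟨f.2, rfl⟩
    exact (mem_erase.1 this).1

def StarD (G : SimpleGraph V) (y : Fin 4 × Fin 3 → V) : SimpleGraph (Fin 4 × Fin 3) where
  Adj f g := f ≠ g ∧ (f.1 = g.1 ∨ G.Adj (y f) (y g))
  symm := ⟨fun _ _ h => ⟨h.1.symm, h.2.imp Eq.symm fun h => h.symm⟩⟩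
  loopless := ⟨fun _ h => h.1 rfl⟩

instance (y : Fin 4 × Fin 3 → V) : DecidableRel (StarD G y).Adj :=
  fun f g => inferInstanceAs (Decidable (f ≠ g ∧ (f.1 = g.1 ∨ G.Adj (y f) (y g))))

namespace Star
variable {v : V} {x : Fin 4 → V} {y : Fin 4 × Fin 3 → V}

lemma vx (S : Star G A v x y) (i : Fin 4) : G.Adj v (x i) := (S.hx _).2 ⟨i, rfl⟩

lemma xy (S : Star G A v x y) (f : Fin 4 × Fin 3) : G.Adj (x f.1) (y f) :=
  (S.hy _ _).2 (Or.inr ⟨f.2, rfl⟩)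

lemma Ty (H : MinBad G L A) (S : Star G A v x y) (f : Fin 4 × Fin 3) : TT A (y f) :=
  TT_adj H _ _ (TT_adj H _ _ S.Tv (S.vx f.1)) (S.xy f)

lemma xx (H : MinBad G L A) (S : Star G A v x y) (i k : Fin 4) : ¬ G.Adj (x i) (x k) := fun h =>
  no_tri H v (x i) (x k) S.Tv (S.vx i) h (S.vx k)

lemma yx (H : MinBad G L A) (S : Star G A v x y) (f : Fin 4 × Fin 3) (k : Fin 4) : y f ≠ x k :=
  fun h => S.xx H f.1 k (h ▸ S.xy f)

lemma cross (H : MinBad G L A) (S : Star G A v x y) (f : Fin 4 × Fin 3) (k : Fin 4) (h : f.1 ≠ k) :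
    ¬ G.Adj (x k) (y f) := fun hh =>
  no_C4 H v (x f.1) (y f) (x k) S.Tv (S.vx _) (S.xy f) hh.symm (S.vx k).symm (S.yv f).symm
    (fun e => h (S.xi e))

lemma yinj (H : MinBad G L A) (S : Star G A v x y) (f g : Fin 4 × Fin 3) (h : y f = y g) : f = g := by
  by_cases hfg : f.1 = g.1
  · exact S.yi f g hfg h
  · exact absurd (h ▸ S.xy g) (S.cross H f g.1 hfg)

lemma gad (H : MinBad G L A) (S : Star G A v x y) : Gad (StarD G y) Prod.fst := by
  refine ⟨fun f g h1 h2 => ⟨h1, Or.inl h2⟩, ?_, ?_⟩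
  · intro f g g' h1 h2 h3 h4
    have a1 := h1.2.resolve_left h3
    have a2 := h2.2.resolve_left (h4 ▸ h3)
    by_contra hne
    refine no_C4 H (y f) (y g) (x g.1) (y g') (S.Ty H f) a1 (S.xy g).symm ?_ a2.symm (S.yx H f _) ?_
    · rw [h4]; exact S.xy g'
    · exact fun e => hne (S.yi _ _ h4 e)
  · intro f g h h1 h2 h3 e1 e2 e3
    exact no_tri H (y f) (y g) (y h) (S.Ty H f) (h1.2.resolve_left e1) (h2.2.resolve_left e2)
      (h3.2.resolve_left e3)

lemma close (H : MinBad G L A) (S : Star G A v x y) (f g : Fin 4 × Fin 3)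
    (hne : s(x f.1, y f) ≠ s(x g.1, y g)) (h : EdgeClose G s(x f.1, y f) s(x g.1, y g)) :
    (StarD G y).Adj f g := by
  refine ⟨fun e => hne (by rw [e]), ?_⟩
  by_cases hfg : f.1 = g.1
  · exact Or.inl hfg
  right
  obtain ⟨u, w, hu, hw, huw⟩ := h
  rw [Sym2.mem_iff] at hu hw
  rcases hu with rfl | rfl <;> rcases hw with rfl | rfl <;> rcases huw with huw | huw
  · exact absurd (S.xi huw) hfg
  · exact absurd huw (S.xx H _ _)
  · exact absurd huw.symm (S.yx H _ _)
  · exact absurd huw (S.cross H g _ (Ne.symm hfg))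
  · exact absurd huw (S.yx H _ _)
  · exact absurd huw.symm (S.cross H f _ hfg)
  · exact absurd (congrArg Prod.fst (S.yinj H _ _ huw)) hfg
  · exact huw

lemma oov (H : MinBad G L A) (S : Star G A v x y) : oo A (touch G x) v = 0 := by
  unfold oo
  rw [card_eq_zero, filter_eq_empty_iff]
  intro e he hpe
  obtain ⟨t, rfl⟩ := Sym2.mem_iff_exists.1 hpe
  have hadj : G.Adj v t := by simpa using H.hA _ (mem_sdiff.1 he).1
  obtain ⟨i, rfl⟩ := (S.hx t).1 hadj
  exact (mem_sdiff.1 he).2 (mem_touch' x i v hadj)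

lemma outs_ke (H : MinBad G L A) (S : Star G A v x y) (i : Fin 4) :
    outs G A (touch G x) s(x i, v) ≤ 9 := by
  refine (outs_le' H _ _ _ (mem_touch x i v (S.vx i).symm)).trans ?_
  have h2 : ∑ p ∈ (G.neighborFinset v).erase (x i), oo A (touch G x) p = 0 := by
    apply sum_eq_zero
    intro p hp
    simp only [mem_erase, SimpleGraph.mem_neighborFinset, S.hx] at hp
    obtain ⟨-, k, rfl⟩ := hp
    exact oo_touch0 H x k
  have h1 := sum_le_of_sub ((G.neighborFinset (x i)).erase v) (oo A (touch G x)) 3 3 (by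
    intro p hp
    simp only [mem_erase, SimpleGraph.mem_neighborFinset] at hp
    exact oo_touch3 H x i p hp.2) (nb_card H _ _ (S.vx i).symm)
  omega

lemma outs_fe (H : MinBad G L A) (S : Star G A v x y) (f : Fin 4 × Fin 3) :
    #{g | (StarD G y).Adj f g} + 2 + outs G A (touch G x) s(x f.1, y f) ≤ 22 := by
  have h0 := outs_le' H _ _ _ (mem_touch x f.1 (y f) (S.xy f))
  have hv : v ∈ (G.neighborFinset (x f.1)).erase (y f) := by
    simp [(S.vx f.1).symm, (S.yv f).symm]
  rw [← add_sum_erase _ _ hv, S.oov H] at h0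
  have hc := nb_card H _ _ (S.xy f)
  have hc' := card_erase_add_one hv
  have h1 := sum_le_of_sub (((G.neighborFinset (x f.1)).erase (y f)).erase v) (oo A (touch G x)) 3 2 (by
    intro p hp
    simp only [mem_erase, SimpleGraph.mem_neighborFinset] at hp
    exact oo_touch3 H x f.1 p hp.2.2) (by omega)
  set Z := (G.neighborFinset (y f)).erase (x f.1) with hZ
  have hZc : #Z ≤ 3 := nb_card H _ _ (S.xy f).symm
  set X : Finset (Fin 4 × Fin 3) := {g | f.1 ≠ g.1 ∧ G.Adj (y f) (y g)} with hX
  have hXC : #(X.image y) = #X := card_image_of_injective _ (fun a b h => S.yinj H a b h)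
  have hsub : X.image y ⊆ Z := by
    intro z hz
    obtain ⟨g, hg, rfl⟩ := mem_image.1 hz
    rw [hX, mem_filter] at hg
    rw [hZ, mem_erase, SimpleGraph.mem_neighborFinset]
    exact ⟨S.yx H _ _, hg.2.2⟩
  have h2 : ∑ z ∈ Z, oo A (touch G x) z + #X ≤ 12 := by
    have e : #X = ∑ z ∈ Z, if z ∈ X.image y then 1 else 0 := by
      rw [← card_filter, filter_mem_eq_inter, inter_eq_right.2 hsub, hXC]
    rw [e, ← sum_add_distrib]
    refine sum_le_of_sub Z _ 4 3 ?_ hZc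
    intro z hz
    split_ifs with hzc
    · obtain ⟨g, hg, rfl⟩ := mem_image.1 hzc
      have := oo_touch3 H x g.1 _ (S.xy g)
      omega
    · have := oo_le4 H (touch G x) z
      omega
  have h3 : #{g | (StarD G y).Adj f g} ≤ #X + 2 := by
    have hs : ({g | (StarD G y).Adj f g} : Finset _) ⊆
        X ∪ ({(f.1, f.2 + 1), (f.1, f.2 + 2)} : Finset (Fin 4 × Fin 3)) := by
      intro g hg
      rw [mem_filter] at hg
      obtain ⟨-, hne, hg⟩ := hg
      rw [mem_union]
      by_cases hfg : f.1 = g.1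
      · right
        obtain ⟨i, j⟩ := f
        obtain ⟨k, l⟩ := g
        simp only at hfg
        subst hfg
        have : l = j + 1 ∨ l = j + 2 := by
          have : j ≠ l := fun h => hne (by rw [h])
          clear * - this
          revert j l; decide
        rcases this with rfl | rfl <;> simp
      · left
        rw [hX, mem_filter]
        exact ⟨mem_univ _, hfg, hg.resolve_left hfg⟩
    refine (card_le_card hs).trans ((card_union_le _ _).trans ?_)
    exact Nat.add_le_add_left card_le_two _
  omega

lemma false (H : MinBad G L A) (S : Star G A v x y) : False := by
  obtain ⟨w, hw⟩ := S.Tv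
  have hTx : TT A (x 0) := TT_adj H _ _ S.Tv (S.vx 0)
  refine reduce H (touch G x) (touch_edge x) (touch_A H x 0 hTx) (fun i => s(x i, v))
    (fun f : Fin 4 × Fin 3 => s(x f.1, y f)) ?_ ?_ ?_ (StarD G y) ?_ (fun _ => 13)
    (fun f => #{g | (StarD G y).Adj f g} + 2) ?_ (S.outs_fe H) ?_
  · exact fun i => mem_touch x i v (S.vx i).symm
  · exact fun f => mem_touch x f.1 _ (S.xy f)
  · intro e he
    obtain ⟨i, w, hw, rfl⟩ := touch_cov x e he
    rw [S.hy] at hw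
    rcases hw with rfl | ⟨j, rfl⟩
    · exact Or.inl ⟨i, rfl⟩
    · exact Or.inr ⟨(i, j), rfl⟩
  · exact S.close H
  · intro i
    have := S.outs_ke H i
    omega
  · intro L M hL hM
    refine stage0 (StarD G y) Prod.fst (S.gad H) univ L M ?_ hM ?_
    · intro i
      unfold bs
      revert i
      decide
    · intro f _
      exact hL f

end Star

lemma noBad (H : MinBad G L A) : False := by
  by_cases h : ∃ v, TT A v
  · obtain ⟨v, hv⟩ := h
    obtain ⟨x, y, S⟩ := mkStar H v hv
    exact S.false H
  · apply H.hnc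
    have : A = ∅ := by
      rw [eq_empty_iff_forall_notMem]
      intro e
      induction e with
      | _ a b => exact fun he => h ⟨a, b, he⟩
    subst this
    exact ⟨fun _ => 0, by simp, by simp⟩

lemma allCol (hΔ : ∀ v, G.degree v ≤ 4) (hL : ∀ e ∈ G.edgeSet, 22 ≤ #(L e)) (B : Finset (Sym2 V))
    (hB : ∀ e ∈ B, e ∈ G.edgeSet) : Col G L B := by
  induction B using Finset.strongInduction with
  | _ B ih =>
    by_contra hn
    exact noBad (L := L) (A := B) ⟨hΔ, hB, hL, hn, fun C hC => ih C hC (fun e he => hB e (hC.1 he))⟩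

end
end SEC

theorem strongly_22_edge_choosable_of_maxDegree_le_four
    {V : Type*} [Fintype V] (G : SimpleGraph V) [DecidableRel G.Adj]
    (hΔ : ∀ v, G.degree v ≤ 4) :
    StronglyEdgeChoosable G 22 := by
  classical
  intro L hL
  obtain ⟨c, h1, h2⟩ := SEC.allCol (G := G) (L := L) hΔ hL G.edgeFinset (by simp)
  refine ⟨c, ?_, ?_⟩
  · intro e he e' he' hne hcl
    exact h2 e (by simpa using he) e' (by simpa using he') hne hcl
  · intro e he
    exact h1 e (by simpa using he)
end

section
/- Let G be a simple 4-regular graph with girth at least 6, let v be a vertex of G with incident edges e₁, e₂, e₃, e₄, and for each i ∈ {1,2,3,4} let A_i be the set of the three edges that are adjacent to e_i but not incident with v. Let L be a list assignment with |L(e)| ≥ 22 for every edge e. Then for any choice of one edge f_i ∈ A_i and one color x_i ∈ L(f_i) for each i ∈ {1,2,3,4}, there exists a strong edge-coloring c of the graph G − v (deleting v and its incident edges) with c(e) ∈ L(e) for all edges e of G − v and c(f_i) = x_i for each i ∈ {1,2,3,4}. -/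
theorem aux_greedy {E : Type*} [DecidableEq E] (R : E → E → Prop) (hR : ∀ a b, R a b → R b a)
    (L : E → Finset ℕ) (ρ : E → ℕ) (P : Finset E) (c0 : E → ℕ)
    (hP : ∀ a ∈ P, ∀ b ∈ P, a ≠ b → R a b → c0 a ≠ c0 b) :
    ∀ (n : ℕ) (S : Finset E), S.card = n → P ⊆ S →
    (∀ a ∈ S, a ∉ P → ∀ B : Finset E,
      (∀ b ∈ B, b ∈ S ∧ b ≠ a ∧ R a b ∧ (b ∈ P ∨ ρ a ≤ ρ b)) → B.card < (L a).card) →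
    ∃ c : E → ℕ, (∀ a ∈ S, ∀ b ∈ S, a ≠ b → R a b → c a ≠ c b) ∧
      (∀ a ∈ S, a ∉ P → c a ∈ L a) ∧ ∀ a ∈ P, c a = c0 a := by
  classical
  intro n
  induction n with
  | zero =>
    intro S hS hPS _
    have : S = ∅ := Finset.card_eq_zero.mp hS
    subst this
    exact ⟨c0, by simp, by simp, fun _ _ => rfl⟩
  | succ n ih =>
    intro S hS hPS hcnt
    by_cases hne : (S \ P).Nonempty
    · obtain ⟨a, ha, hmin⟩ := Finset.exists_min_image (S \ P) ρ hne
      rw [Finset.mem_sdiff] at ha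
      obtain ⟨c, hc1, hc2, hc3⟩ := ih (S.erase a) (by rw [Finset.card_erase_of_mem ha.1]; omega)
        (fun p hp => Finset.mem_erase.2 ⟨fun h => ha.2 (h ▸ hp), hPS hp⟩)
        (fun b hb hbP B hB => hcnt b (Finset.mem_of_mem_erase hb) hbP B
          (fun d hd => ⟨Finset.mem_of_mem_erase (hB d hd).1, (hB d hd).2⟩))
      let B := S.filter (fun b => b ≠ a ∧ R a b)
      have hB := hcnt a ha.1 ha.2 B (by
        intro b hb
        simp only [B, Finset.mem_filter] at hb
        refine ⟨hb.1, hb.2.1, hb.2.2, ?_⟩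
        by_cases hbP : b ∈ P
        · exact Or.inl hbP
        · exact Or.inr (hmin b (Finset.mem_sdiff.2 ⟨hb.1, hbP⟩)))
      obtain ⟨y, hy, hyB⟩ := Finset.exists_mem_notMem_of_card_lt_card
        (lt_of_le_of_lt (Finset.card_image_le (s := B) (f := c)) hB)
      have hyc : ∀ b ∈ S, b ≠ a → R a b → c b ≠ y := by
        intro b hb hba hr h
        exact hyB (Finset.mem_image.2 ⟨b, by simp [B, hb, hba, hr], h⟩)
      refine ⟨Function.update c a y, ?_, ?_, ?_⟩
      · intro p hp q hq hpq hr
        by_cases h1 : p = a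
        · subst h1
          rw [Function.update_self, Function.update_of_ne (Ne.symm hpq)]
          exact (hyc q hq (Ne.symm hpq) hr).symm
        · by_cases h2 : q = a
          · subst h2
            rw [Function.update_self, Function.update_of_ne hpq]
            exact hyc p hp hpq (hR _ _ hr)
          · rw [Function.update_of_ne h1, Function.update_of_ne h2]
            exact hc1 p (Finset.mem_erase.2 ⟨h1, hp⟩) q (Finset.mem_erase.2 ⟨h2, hq⟩) hpq hr
      · intro p hp hpP
        by_cases h1 : p = a
        · subst h1; rw [Function.update_self]; exact hy
        · rw [Function.update_of_ne h1]; exact hc2 p (Finset.mem_erase.2 ⟨h1, hp⟩) hpP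
      · intro p hp
        have h1 : p ≠ a := fun h => ha.2 (h ▸ hp)
        rw [Function.update_of_ne h1]; exact hc3 p hp
    · have hSP : S ⊆ P := by
        rwa [Finset.not_nonempty_iff_eq_empty, Finset.sdiff_eq_empty_iff_subset] at hne
      exact ⟨c0, fun a ha b hb => hP a (hSP ha) b (hSP hb),
        fun a ha haP => absurd (hSP ha) haP, fun _ _ => rfl⟩

theorem aux_double (A B : Fin 4 → Finset ℕ) :
    ∑ j, ∑ y ∈ A j, (Finset.univ.filter (fun i => y ∈ B i)).card
      = ∑ i, ∑ y ∈ B i, (Finset.univ.filter (fun j => y ∈ A j)).card := by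
  have h : ∀ (A B : Fin 4 → Finset ℕ) (j : Fin 4),
      ∑ y ∈ A j, (Finset.univ.filter (fun i => y ∈ B i)).card = ∑ i, (A j ∩ B i).card := by
    intro A B j
    simp only [Finset.card_filter]
    rw [Finset.sum_comm]
    refine Finset.sum_congr rfl (fun i _ => ?_)
    rw [← Finset.card_filter, Finset.filter_mem_eq_inter]
  simp only [h]
  rw [Finset.sum_comm]
  simp only [Finset.inter_comm]

theorem aux_pick (C Ls : Fin 4 → Finset ℕ) (hC : ∀ j, (C j).card = 22)
    (hLs : ∀ i, (Ls i).card = 22) :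
    ∃ x : Fin 4 → ℕ, (∀ j, x j ∈ C j) ∧
      ∑ y ∈ Finset.univ.image x, (Finset.univ.filter (fun i => y ∈ Ls i)).card ≤ 7 := by
  classical
  set N : ℕ → ℕ := fun y => (Finset.univ.filter (fun i => y ∈ Ls i)).card with hN
  set M : ℕ → ℕ := fun y => (Finset.univ.filter (fun i => y ∈ C i)).card with hM
  have hN4 : ∀ y, N y ≤ 4 := fun y => (Finset.card_le_univ _).trans (by simp)
  have hne : ∀ j, (C j).Nonempty := fun j => Finset.card_pos.1 (by rw [hC]; norm_num)
  by_cases h3 : ∃ y, 3 ≤ M y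
  · obtain ⟨y, hy⟩ := h3
    by_cases hall : ∀ j, y ∈ C j
    · refine ⟨fun _ => y, hall, ?_⟩
      have : Finset.univ.image (fun _ : Fin 4 => y) ⊆ {y} := by
        intro z hz; simp at hz; simp [hz]
      calc _ ≤ ∑ z ∈ {y}, N z := Finset.sum_le_sum_of_subset this
        _ = N y := by simp
        _ ≤ 7 := (hN4 y).trans (by norm_num)
    · push Not at hall
      obtain ⟨k, hk⟩ := hall
      have hoth : ∀ j, j ≠ k → y ∈ C j := by
        intro j hj
        by_contra hcon
        have hsub : Finset.univ.filter (fun i => y ∈ C i) ⊆ (Finset.univ.erase k).erase j := by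
          intro i hi
          simp at hi
          simp
          exact ⟨fun h => hcon (h ▸ hi), fun h => hk (h ▸ hi)⟩
        have := Finset.card_le_card hsub
        rw [Finset.card_erase_of_mem (by simp [hj]), Finset.card_erase_of_mem (by simp)] at this
        simp at this
        simp only [hM] at hy
        omega
      have hz : ∃ z ∈ C k, N y + N z ≤ 7 := by
        by_contra hcon
        push Not at hcon
        have hsub : C k ⊆ Ls 0 := by
          intro z hz
          have := hcon z hz
          have h4 : N z = 4 := by have := hN4 y; have := hN4 z; omega
          have : Finset.univ.filter (fun i => z ∈ Ls i) = Finset.univ :=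
            (Finset.card_eq_iff_eq_univ _).1 (by simpa using h4)
          have := this ▸ Finset.mem_univ (0 : Fin 4)
          simpa using this
        have heq := Finset.eq_of_subset_of_card_le hsub (by rw [hC, hLs])
        obtain ⟨z, hz⟩ := hne k
        have := hcon z hz
        have h4 : N y = 4 := by have := hN4 y; have := hN4 z; omega
        have : Finset.univ.filter (fun i => y ∈ Ls i) = Finset.univ :=
            (Finset.card_eq_iff_eq_univ _).1 (by simpa using h4)
        have := this ▸ Finset.mem_univ (0 : Fin 4)
        apply hk
        rw [heq]
        simpa using this
      obtain ⟨z, hz, hz7⟩ := hz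
      refine ⟨fun j => if j = k then z else y, ?_, ?_⟩
      · intro j
        dsimp only
        split_ifs with h
        · rw [h]; exact hz
        · exact hoth j h
      · have : Finset.univ.image (fun j : Fin 4 => if j = k then z else y) ⊆ {y, z} := by
          intro w hw
          simp only [Finset.mem_image, Finset.mem_univ, true_and] at hw
          obtain ⟨j, rfl⟩ := hw
          split_ifs <;> simp
        calc _ ≤ ∑ w ∈ {y, z}, N w := Finset.sum_le_sum_of_subset this
          _ ≤ ∑ w ∈ {y}, N w + ∑ w ∈ {z}, N w := by
            rw [← Finset.sum_union_inter]; exact Nat.le_add_right _ _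
          _ = N y + N z := by simp
          _ ≤ 7 := hz7
  · push Not at h3
    have hM2 : ∀ y, M y ≤ 2 := fun y => by have := h3 y; omega
    have hx : ∀ j, ∃ z ∈ C j, ∀ w ∈ C j, N z ≤ N w := fun j => Finset.exists_min_image (C j) N (hne j)
    choose x hx hmin using hx
    by_cases h7 : ∑ j, N (x j) ≤ 7
    · refine ⟨x, hx, le_trans ?_ h7⟩
      exact Finset.sum_image_le_of_nonneg (fun _ _ => Nat.zero_le _)
    · have hD := aux_double C Ls
      have hup : ∀ i, ∑ y ∈ Ls i, M y ≤ 44 := fun i => by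
        calc _ ≤ ∑ y ∈ Ls i, 2 := Finset.sum_le_sum (fun y _ => hM2 y)
          _ = 44 := by simp [hLs]
      have hlo : ∀ j, 22 * N (x j) ≤ ∑ y ∈ C j, N y := fun j => by
        calc 22 * N (x j) = ∑ y ∈ C j, N (x j) := by simp [hC]
          _ ≤ _ := Finset.sum_le_sum (fun y hy => hmin j y hy)
      change ∑ j, ∑ y ∈ C j, N y = ∑ i, ∑ y ∈ Ls i, M y at hD
      have hupS : ∑ i, ∑ y ∈ Ls i, M y ≤ 176 := by
        calc _ ≤ ∑ i : Fin 4, 44 := Finset.sum_le_sum (fun i _ => hup i)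
          _ = 176 := by simp
      have hloS : 22 * ∑ j, N (x j) ≤ ∑ j, ∑ y ∈ C j, N y := by
        rw [Finset.mul_sum]; exact Finset.sum_le_sum (fun j _ => hlo j)
      have h8 : ∑ j, N (x j) = 8 := by omega
      have hloE : ∀ j, 22 * N (x j) = ∑ y ∈ C j, N y := by
        intro j
        refine (Finset.sum_eq_sum_iff_of_le (fun j _ => hlo j)).1 ?_ j (Finset.mem_univ j)
        rw [← Finset.mul_sum]; omega
      have hupE : ∑ y ∈ Ls 0, M y = 44 := by
        refine (Finset.sum_eq_sum_iff_of_le (fun i _ => hup i)).1 ?_ 0 (Finset.mem_univ 0)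
        simp; omega
      obtain ⟨y, hy⟩ : (Ls 0).Nonempty := Finset.card_pos.1 (by rw [hLs]; norm_num)
      have hMy : M y = 2 :=
        (Finset.sum_eq_sum_iff_of_le (fun y _ => hM2 y)).1 (by rw [hupE]; simp [hLs]) y hy
      have hNy : 1 ≤ N y := Finset.card_pos.2 ⟨0, by simpa using hy⟩
      obtain ⟨j, k, hjk, hjkE⟩ := Finset.card_eq_two.1 hMy
      have hyj : y ∈ C j := by
        have : j ∈ Finset.univ.filter (fun i => y ∈ C i) := by rw [hjkE]; simp
        simpa using this
      have hyk : y ∈ C k := by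
        have : k ∈ Finset.univ.filter (fun i => y ∈ C i) := by rw [hjkE]; simp
        simpa using this
      have hNj : N (x k) = N y :=
        (Finset.sum_eq_sum_iff_of_le (fun y hy => hmin k y hy)).1
          (by rw [← hloE k]; simp [hC]) y hyk
      refine ⟨fun l => if l = k then y else if l = j then y else x l, ?_, ?_⟩
      · intro l
        dsimp only
        split_ifs with h h'
        · rw [h]; exact hyk
        · rw [h']; exact hyj
        · exact hx l
      · have hsub : Finset.univ.image (fun l => if l = k then y else if l = j then y else x l) ⊆
            (Finset.univ.erase k).image (fun l => if l = j then y else x l) := by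
          intro w hw
          simp only [Finset.mem_image, Finset.mem_univ, true_and] at hw
          obtain ⟨l, rfl⟩ := hw
          simp only [Finset.mem_image, Finset.mem_erase, Finset.mem_univ, and_true]
          by_cases h : l = k
          · exact ⟨j, hjk, by simp [h]⟩
          · exact ⟨l, h, by simp [h]⟩
        have hNj' : N (x j) = N y :=
          (Finset.sum_eq_sum_iff_of_le (fun y hy => hmin j y hy)).1
            (by rw [← hloE j]; simp [hC]) y hyj
        calc _ ≤ ∑ w ∈ (Finset.univ.erase k).image (fun l => if l = j then y else x l), N w :=
              Finset.sum_le_sum_of_subset hsub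
          _ ≤ ∑ l ∈ Finset.univ.erase k, N (if l = j then y else x l) :=
              Finset.sum_image_le_of_nonneg (fun _ _ => Nat.zero_le _)
          _ = ∑ l ∈ Finset.univ.erase k, N (x l) := by
              refine Finset.sum_congr rfl (fun l _ => ?_)
              split_ifs with h
              · rw [h, hNj']
              · rfl
          _ ≤ 7 := by
              have := Finset.add_sum_erase Finset.univ (fun l => N (x l)) (Finset.mem_univ k)
              omega

theorem aux_sdr (A : Fin 4 → Finset ℕ) (r : Fin 4 → ℕ) (hr4 : ∀ i, r i ≤ 4)
    (hr : ∑ i, r i ≤ 7) (hA : ∀ i, 5 ≤ (A i).card + r i) :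
    ∃ y : Fin 4 → ℕ, Function.Injective y ∧ ∀ i, y i ∈ A i := by
  classical
  refine (Finset.all_card_le_biUnion_card_iff_exists_injective A).1 ?_
  intro s
  by_contra hcon
  push Not at hcon
  have h1 : ∀ i ∈ s, 6 ≤ r i + s.card := by
    intro i hi
    have := Finset.card_le_card (Finset.subset_biUnion_of_mem A hi)
    have := hA i
    omega
  have h2 : ∑ i ∈ s, r i ≤ 7 := (Finset.sum_le_sum_of_subset (Finset.subset_univ s)).trans hr
  have h3 : s.card * (6 - s.card) ≤ ∑ i ∈ s, r i := by
    rw [← smul_eq_mul]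
    exact Finset.card_nsmul_le_sum _ _ _ (fun i hi => by have := h1 i hi; omega)
  have h4 : s.card ≤ 4 := (Finset.card_le_univ s).trans (by simp)
  have h5 : 0 < s.card := by omega
  obtain ⟨i, hi⟩ := Finset.card_pos.1 h5
  have h6 := h1 i hi
  have h7 := hr4 i
  generalize s.card = m at *
  interval_cases m <;> omega

theorem aux_c3 {V : Type*} (G : SimpleGraph V) (hg : 6 ≤ G.girth) {a b c : V}
    (h1 : G.Adj a b) (h2 : G.Adj b c) (h3 : G.Adj c a) : False := by
  have hc : (SimpleGraph.Walk.cons h1 (.cons h2 (.cons h3 .nil))).IsCycle := by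
    have := h1.ne; have := h2.ne; have := h3.ne
    simp [SimpleGraph.Walk.isCycle_def, SimpleGraph.Walk.isTrail_def]
    grind
  have := SimpleGraph.girth_le_length hc
  simp at this
  omega

theorem aux_c4 {V : Type*} (G : SimpleGraph V) (hg : 6 ≤ G.girth) {a b c d : V}
    (h1 : G.Adj a b) (h2 : G.Adj b c) (h3 : G.Adj c d) (h4 : G.Adj d a) (h5 : a ≠ c)
    (h6 : b ≠ d) : False := by
  have hc : (SimpleGraph.Walk.cons h1 (.cons h2 (.cons h3 (.cons h4 .nil)))).IsCycle := by
    have := h1.ne; have := h2.ne; have := h3.ne; have := h4.ne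
    simp [SimpleGraph.Walk.isCycle_def, SimpleGraph.Walk.isTrail_def]
    grind
  have := SimpleGraph.girth_le_length hc
  simp at this
  omega

theorem aux_c5 {V : Type*} (G : SimpleGraph V) (hg : 6 ≤ G.girth) {a b c d e : V}
    (h1 : G.Adj a b) (h2 : G.Adj b c) (h3 : G.Adj c d) (h4 : G.Adj d e) (h5 : G.Adj e a) :
    False := by
  have n1 : a ≠ c := by rintro rfl; exact aux_c3 G hg h3 h4 h5
  have n2 : b ≠ d := by rintro rfl; exact aux_c3 G hg h4 h5 h1
  have n3 : c ≠ e := by rintro rfl; exact aux_c3 G hg h5 h1 h2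
  have n4 : d ≠ a := by rintro rfl; exact aux_c3 G hg h1 h2 h3
  have n5 : e ≠ b := by rintro rfl; exact aux_c3 G hg h2 h3 h4
  have hc : (SimpleGraph.Walk.cons h1 (.cons h2 (.cons h3 (.cons h4 (.cons h5 .nil))))).IsCycle := by
    have := h1.ne; have := h2.ne; have := h3.ne; have := h4.ne; have := h5.ne
    simp [SimpleGraph.Walk.isCycle_def, SimpleGraph.Walk.isTrail_def]
    grind
  have := SimpleGraph.girth_le_length hc
  simp at this
  omega

theorem aux_nonclose {V : Type*} (G : SimpleGraph V) (hg : 6 ≤ G.girth) {v u₁ u₂ w₁ w₂ : V}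
    (h1 : G.Adj v u₁) (h2 : G.Adj v u₂) (hne : u₁ ≠ u₂) (h3 : G.Adj u₁ w₁) (h4 : G.Adj u₂ w₂)
    (hw1 : w₁ ≠ v) (hw2 : w₂ ≠ v) : ¬ EdgeClose G s(u₁, w₁) s(u₂, w₂) := by
  rintro ⟨p, q, hp, hq, hpq⟩
  rw [Sym2.mem_iff] at hp hq
  rcases hp with rfl | rfl <;> rcases hq with rfl | rfl <;> rcases hpq with h | h
  · exact hne h
  · exact aux_c3 G hg h1 h h2.symm
  · subst h; exact aux_c3 G hg h1 h4.symm h2.symm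
  · exact aux_c4 G hg h1 h h4.symm h2.symm hw2.symm hne
  · subst h; exact aux_c3 G hg h2 h3.symm h1.symm
  · exact aux_c4 G hg h1 h3 h h2.symm hw1.symm hne
  · subst h; exact aux_c4 G hg h1 h3 h4.symm h2.symm hw1.symm hne
  · exact aux_c5 G hg h1 h3 h h4.symm h2.symm

theorem aux_close_symm {V : Type*} (G : SimpleGraph V) (a b : Sym2 V) (h : EdgeClose G a b) :
    EdgeClose G b a := by
  obtain ⟨p, q, hp, hq, h⟩ := h
  exact ⟨q, p, hq, hp, h.imp Eq.symm SimpleGraph.Adj.symm⟩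

theorem aux_edge_reach {V : Type*} (G : SimpleGraph V) {a : Sym2 V} (ha : a ∈ G.edgeSet) {u w : V}
    (hu : u ∈ a) (hw : w ∈ a) : G.Reachable u w := by
  induction a with | _ p q
  rw [SimpleGraph.mem_edgeSet] at ha
  rw [Sym2.mem_iff] at hu hw
  rcases hu with rfl | rfl <;> rcases hw with rfl | rfl
  · exact SimpleGraph.Reachable.refl _
  · exact ha.reachable
  · exact ha.symm.reachable
  · exact SimpleGraph.Reachable.refl _

theorem aux_close_reach {V : Type*} (G : SimpleGraph V) {a b : Sym2 V} (ha : a ∈ G.edgeSet)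
    (hb : b ∈ G.edgeSet) (h : EdgeClose G a b) {u w : V}
    (hu : u ∈ a) (hw : w ∈ b) : G.Reachable u w := by
  obtain ⟨p, q, hp, hq, h⟩ := h
  have h1 := aux_edge_reach G ha hu hp
  have h2 := aux_edge_reach G hb hq hw
  rcases h with rfl | h
  · exact h1.trans h2
  · exact (h1.trans h.reachable).trans h2

theorem aux_card {V : Type*} [Fintype V] [DecidableEq V] (G : SimpleGraph V) [DecidableRel G.Adj]
    (hreg : ∀ u, G.degree u = 4) {a : Sym2 V} (ha : a ∈ G.edgeSet) (B : Finset (Sym2 V))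
    (hB : ∀ b ∈ B, b ∈ G.edgeSet ∧ b ≠ a ∧ EdgeClose G a b) : B.card ≤ 24 := by
  induction a with | _ p q
  rw [SimpleGraph.mem_edgeSet] at ha
  have key : ∀ p q : V, G.Adj p q →
      (((G.neighborFinset p).erase q).biUnion (fun w => G.incidenceFinset w)).card ≤ 12 := by
    intro p q h
    refine (Finset.card_biUnion_le_card_mul _ _ 4 (fun w _ => ?_)).trans ?_
    · rw [SimpleGraph.card_incidenceFinset_eq_degree, hreg]
    · rw [Finset.card_erase_of_mem (by simpa using h), SimpleGraph.card_neighborFinset_eq_degree, hreg]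
  have hsub : B ⊆ (((G.neighborFinset p).erase q).biUnion (fun w => G.incidenceFinset w)) ∪
      (((G.neighborFinset q).erase p).biUnion (fun w => G.incidenceFinset w)) := by
    -- an edge b through p, different from pq
    have thr : ∀ p q : V, ∀ b ∈ G.edgeSet, b ≠ s(p, q) → p ∈ b →
        b ∈ (((G.neighborFinset p).erase q).biUnion (fun w => G.incidenceFinset w)) := by
      intro p q b hb hne hp
      obtain ⟨w, rfl⟩ := hp
      rw [SimpleGraph.mem_edgeSet] at hb
      rw [Finset.mem_biUnion]
      refine ⟨w, ?_, ?_⟩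
      · rw [Finset.mem_erase, SimpleGraph.mem_neighborFinset]
        exact ⟨fun h => hne (by rw [h]), hb⟩
      · rw [SimpleGraph.mem_incidenceFinset]
        exact ⟨hb, by simp⟩
    have nb : ∀ p q w : V, ∀ b ∈ G.edgeSet, G.Adj p w → w ≠ q → w ∈ b →
        b ∈ (((G.neighborFinset p).erase q).biUnion (fun w => G.incidenceFinset w)) := by
      intro p q w b hb hpw hne hw
      rw [Finset.mem_biUnion]
      refine ⟨w, ?_, ?_⟩
      · rw [Finset.mem_erase, SimpleGraph.mem_neighborFinset]
        exact ⟨hne, hpw⟩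
      · rw [SimpleGraph.mem_incidenceFinset]
        exact ⟨hb, hw⟩
    intro b hb
    obtain ⟨hbE, hbne, u, w, hu, hw, h⟩ := hB b hb
    have hbne' : b ≠ s(q, p) := by rwa [Sym2.eq_swap]
    rw [Finset.mem_union]
    rw [Sym2.mem_iff] at hu
    by_cases hwp : w = p
    · subst hwp; exact Or.inl (thr _ _ b hbE hbne hw)
    by_cases hwq : w = q
    · subst hwq; exact Or.inr (thr _ _ b hbE hbne' hw)
    rcases hu with rfl | rfl <;> rcases h with h | h
    · exact absurd h.symm hwp
    · exact Or.inl (nb _ _ w b hbE h hwq hw)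
    · exact absurd h.symm hwq
    · exact Or.inr (nb _ _ w b hbE h hwp hw)
  have := Finset.card_le_card hsub
  have := Finset.card_union_le (((G.neighborFinset p).erase q).biUnion (fun w => G.incidenceFinset w))
      (((G.neighborFinset q).erase p).biUnion (fun w => G.incidenceFinset w))
  have := key p q ha
  have := key q p ha.symm
  omega

theorem aux_comp {V : Type*} [Fintype V] (G : SimpleGraph V) [DecidableRel G.Adj]
    (hreg : ∀ u, G.degree u = 4) (v : V)
    (L : Sym2 V → Finset ℕ) (hL : ∀ ε ∈ G.edgeSet, 22 ≤ (L ε).card)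
    (f : Fin 4 → Sym2 V)
    (hf : ∀ i, f i ∈ G.edgeSet ∧ v ∉ f i ∧ ∃ u ∈ f i, G.Reachable v u)
    (hfn : ∀ i j, i ≠ j → ¬ EdgeClose G (f i) (f j))
    (x : Fin 4 → ℕ) (hx : ∀ i, x i ∈ L (f i)) :
    ∃ c : Sym2 V → ℕ,
      (∀ a ∈ G.edgeSet, v ∉ a → (∃ u ∈ a, G.Reachable v u) →
        ∀ b ∈ G.edgeSet, v ∉ b → (∃ u ∈ b, G.Reachable v u) →
        a ≠ b → EdgeClose G a b → c a ≠ c b) ∧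
      (∀ a ∈ G.edgeSet, v ∉ a → (∃ u ∈ a, G.Reachable v u) → c a ∈ L a) ∧
      ∀ i, c (f i) = x i := by
  classical
  have hself : ∀ a : Sym2 V, EdgeClose G a a := by
    intro a
    induction a with | _ p q
    exact ⟨p, p, by simp, by simp, Or.inl rfl⟩
  have hfinj : Function.Injective f := by
    intro i j hij
    by_contra hne
    exact hfn i j hne (hij ▸ hself _)
  let S : Finset (Sym2 V) := Finset.univ.filter
    (fun a => a ∈ G.edgeSet ∧ v ∉ a ∧ ∃ u ∈ a, G.Reachable v u)
  let P : Finset (Sym2 V) := Finset.univ.image f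
  let ρ : Sym2 V → ℕ := fun a => sInf {d | ∃ u ∈ a, d = G.dist v u}
  have hρle : ∀ a : Sym2 V, ∀ u ∈ a, ρ a ≤ G.dist v u := fun a u hu => Nat.sInf_le ⟨u, hu, rfl⟩
  have hρ : ∀ a : Sym2 V, ∃ u ∈ a, ρ a = G.dist v u := by
    intro a
    have : {d | ∃ u ∈ a, d = G.dist v u}.Nonempty := by
      induction a with | _ p q
      exact ⟨_, p, by simp, rfl⟩
    exact Nat.sInf_mem this
  have hfx : ∀ i, Function.extend f x (fun _ => 0) (f i) = x i := fun i => hfinj.extend_apply _ _ _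
  obtain ⟨c, h1, h2, h3⟩ := aux_greedy (EdgeClose G) (aux_close_symm G) L ρ P
    (Function.extend f x (fun _ => 0))
    (by
      intro a ha b hb hab hc
      simp only [P, Finset.mem_image, Finset.mem_univ, true_and] at ha hb
      obtain ⟨i, rfl⟩ := ha
      obtain ⟨j, rfl⟩ := hb
      exact absurd hc (hfn i j (fun h => hab (by rw [h]))))
    S.card S rfl
    (by
      intro a ha
      simp only [P, Finset.mem_image, Finset.mem_univ, true_and] at ha
      obtain ⟨i, rfl⟩ := ha
      simpa [S] using hf i)
    (by
      intro a ha haP B hB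
      simp only [S, Finset.mem_filter, Finset.mem_univ, true_and] at ha
      obtain ⟨haE, hva, z, hz, hvz⟩ := ha
      refine lt_of_lt_of_le ?_ (hL a haE)
      obtain ⟨u, hu, hρu⟩ := hρ a
      have hvu : G.Reachable v u := hvz.trans (aux_edge_reach G haE hz hu)
      have hvu' : v ≠ u := fun h => hva (h ▸ hu)
      -- predecessor on a shortest walk
      obtain ⟨t, htu, htd⟩ : ∃ t, G.Adj u t ∧ G.dist v t < G.dist v u := by
        obtain ⟨p, hp⟩ := hvu.symm.exists_walk_length_eq_dist
        rw [SimpleGraph.dist_comm] at hp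
        cases p with
        | nil => exact absurd rfl hvu'
        | cons h p' =>
          refine ⟨_, h, ?_⟩
          have := SimpleGraph.dist_le p'
          rw [SimpleGraph.dist_comm] at this
          simp at hp
          omega
      have hta : t ∉ a := fun h => by have := hρle a t h; omega
      let Q := G.incidenceFinset t \ P
      have hQ : 3 ≤ Q.card := by
        have h1 : (G.incidenceFinset t ∩ P).card ≤ 1 := by
          rw [Finset.card_le_one]
          intro p hp q hq
          simp only [P, Finset.mem_inter, Finset.mem_image, Finset.mem_univ, true_and,
            SimpleGraph.mem_incidenceFinset] at hp hq
          obtain ⟨hp, i, rfl⟩ := hp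
          obtain ⟨hq, j, rfl⟩ := hq
          by_contra hne
          exact hfn i j (fun h => hne (by rw [h])) ⟨t, t, hp.2, hq.2, Or.inl rfl⟩
        have h2 := Finset.card_sdiff_add_card_inter (G.incidenceFinset t) P
        rw [SimpleGraph.card_incidenceFinset_eq_degree, hreg] at h2
        simp only [Q]
        omega
      have hdisj : Disjoint B Q := by
        rw [Finset.disjoint_left]
        intro b hb hbQ
        simp only [Q, Finset.mem_sdiff, SimpleGraph.mem_incidenceFinset] at hbQ
        obtain ⟨_, _, _, h⟩ := hB b hb
        rcases h with h | h
        · exact hbQ.2 h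
        · have := hρle b t hbQ.1.2
          omega
      have := aux_card G hreg haE (B ∪ Q) (by
        intro b hb
        rw [Finset.mem_union] at hb
        rcases hb with hb | hb
        · obtain ⟨hs, hne, hc, _⟩ := hB b hb
          simp only [S, Finset.mem_filter] at hs
          exact ⟨hs.2.1, hne, hc⟩
        · simp only [Q, Finset.mem_sdiff, SimpleGraph.mem_incidenceFinset] at hb
          exact ⟨hb.1.1, fun h => hta (h ▸ hb.1.2), u, t, hu, hb.1.2, Or.inr htu⟩)
      rw [Finset.card_union_of_disjoint hdisj] at this
      omega)
  have hcf : ∀ i, c (f i) = x i := fun i => by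
    rw [h3 (f i) (by simp [P]), hfx]
  refine ⟨c, ?_, ?_, hcf⟩
  · intro a ha1 ha2 ha3 b hb1 hb2 hb3
    exact h1 a (by simp only [S, Finset.mem_filter]; exact ⟨Finset.mem_univ _, ha1, ha2, ha3⟩)
      b (by simp only [S, Finset.mem_filter]; exact ⟨Finset.mem_univ _, hb1, hb2, hb3⟩)
  · intro a ha1 ha2 ha3
    by_cases haP : a ∈ P
    · simp only [P, Finset.mem_image, Finset.mem_univ, true_and] at haP
      obtain ⟨i, rfl⟩ := haP
      rw [hcf]; exact hx i
    · exact h2 a (by simp only [S, Finset.mem_filter]; exact ⟨Finset.mem_univ _, ha1, ha2, ha3⟩) haP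

theorem aux_full {V : Type*} [Fintype V] (G : SimpleGraph V) [DecidableRel G.Adj]
    (hreg : ∀ u, G.degree u = 4) (hg : 6 ≤ G.girth) (v : V)
    (L : Sym2 V → Finset ℕ) (hL : ∀ ε ∈ G.edgeSet, (L ε).card = 22) :
    ∃ c : Sym2 V → ℕ,
      (∀ a ∈ G.edgeSet, (∃ u ∈ a, G.Reachable v u) →
        ∀ b ∈ G.edgeSet, (∃ u ∈ b, G.Reachable v u) →
        a ≠ b → EdgeClose G a b → c a ≠ c b) ∧
      (∀ a ∈ G.edgeSet, (∃ u ∈ a, G.Reachable v u) → c a ∈ L a) := by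
  classical
  obtain ⟨u, huinj, hvu, husurj⟩ : ∃ u : Fin 4 → V, Function.Injective u ∧ (∀ i, G.Adj v (u i)) ∧
      ∀ w, G.Adj v w → ∃ i, u i = w := by
    let eq := (Finset.equivFinOfCardEq (s := G.neighborFinset v) (n := 4)
      (by rw [SimpleGraph.card_neighborFinset_eq_degree, hreg])).symm
    refine ⟨fun i => (eq i : V), fun i j h => eq.injective (Subtype.ext h), fun i => ?_, ?_⟩
    · have := (eq i).2
      rwa [SimpleGraph.mem_neighborFinset] at this
    · intro w hw
      exact ⟨eq.symm ⟨w, by simpa using hw⟩, by simp⟩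
  have hw : ∀ i, ∃ w, G.Adj (u i) w ∧ w ≠ v := by
    intro i
    obtain ⟨w, hw1, hw2⟩ := Finset.exists_mem_ne (s := G.neighborFinset (u i))
      (by rw [SimpleGraph.card_neighborFinset_eq_degree, hreg]; norm_num) v
    exact ⟨w, by simpa using hw1, hw2⟩
  choose w huw hwv using hw
  let e : Fin 4 → Sym2 V := fun i => s(v, u i)
  let f : Fin 4 → Sym2 V := fun i => s(u i, w i)
  have heE : ∀ i, e i ∈ G.edgeSet := fun i => hvu i
  have hfE : ∀ i, f i ∈ G.edgeSet := fun i => huw i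
  have heinj : Function.Injective e := by
    intro i j h
    exact huinj (Sym2.congr_right.1 h)
  have hvf : ∀ i, v ∉ f i := by
    intro i h
    simp only [f, Sym2.mem_iff] at h
    rcases h with h | h
    · exact (hvu i).ne h
    · exact hwv i h.symm
  have hfn : ∀ i j, i ≠ j → ¬ EdgeClose G (f i) (f j) := fun i j hij =>
    aux_nonclose G hg (hvu i) (hvu j) (fun h => hij (huinj h)) (huw i) (huw j) (hwv i) (hwv j)
  have hfinj : Function.Injective f := by
    intro i j hij
    by_contra hne
    refine hfn i j hne ⟨u i, u i, by simp [f], ?_, Or.inl rfl⟩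
    rw [← hij]; simp [f]
  obtain ⟨x, hx, hx7⟩ := aux_pick (fun j => L (f j)) (fun i => L (e i))
    (fun j => hL _ (hfE j)) (fun i => hL _ (heE i))
  obtain ⟨c, hc1, hc2, hc3⟩ := aux_comp G hreg v L (fun ε h => (hL ε h).ge) f
    (fun i => ⟨hfE i, hvf i, u i, by simp [f], (hvu i).reachable⟩) hfn x hx
  let r : Fin 4 → ℕ := fun i => (Finset.univ.image x ∩ L (e i)).card
  have hr4 : ∀ i, r i ≤ 4 := fun i =>
    (Finset.card_le_card Finset.inter_subset_left).trans (Finset.card_image_le.trans (by simp))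
  have hr7 : ∑ i, r i ≤ 7 := by
    refine le_of_eq_of_le ?_ hx7
    simp only [Finset.card_filter]
    rw [Finset.sum_comm]
    refine Finset.sum_congr rfl (fun i _ => ?_)
    rw [← Finset.card_filter, Finset.filter_mem_eq_inter]
  let T : Fin 4 → Finset (Sym2 V) := fun i =>
    Finset.univ.filter (fun b => b ∈ G.edgeSet ∧ v ∉ b ∧ EdgeClose G (e i) b)
  have hT : ∀ i b, b ∈ T i ↔ b ∈ G.edgeSet ∧ v ∉ b ∧ EdgeClose G (e i) b := by
    intro i b; simp only [T, Finset.mem_filter, Finset.mem_univ, true_and]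
  have hve : ∀ i, v ∈ e i := fun i => by simp [e]
  have hT21 : ∀ i, (T i).card ≤ 21 := by
    intro i
    have hd : Disjoint (T i) ((Finset.univ.erase i).image e) := by
      rw [Finset.disjoint_left]
      intro b hb hb'
      rw [Finset.mem_image] at hb'
      obtain ⟨j, _, rfl⟩ := hb'
      exact ((hT i _).1 hb).2.1 (hve j)
    have := aux_card G hreg (heE i) (T i ∪ (Finset.univ.erase i).image e) (by
      intro b hb
      rw [Finset.mem_union] at hb
      rcases hb with hb | hb
      · rw [hT] at hb
        exact ⟨hb.1, fun h => hb.2.1 (h ▸ hve i), hb.2.2⟩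
      · rw [Finset.mem_image] at hb
        obtain ⟨j, hj, rfl⟩ := hb
        exact ⟨heE j, fun h => (Finset.mem_erase.1 hj).1 (heinj h), v, v, hve i, hve j, Or.inl rfl⟩)
    rw [Finset.card_union_of_disjoint hd, Finset.card_image_of_injective _ heinj,
      Finset.card_erase_of_mem (Finset.mem_univ _)] at this
    simp at this
    omega
  have hfT : ∀ i, Finset.univ.image f ⊆ T i := by
    intro i b hb
    simp only [Finset.mem_image, Finset.mem_univ, true_and] at hb
    obtain ⟨j, rfl⟩ := hb
    exact (hT i _).2 ⟨hfE j, hvf j, v, u j, hve i, by simp [f], Or.inr (hvu j)⟩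
  obtain ⟨y, hyinj, hy⟩ := aux_sdr (fun i => L (e i) \ (T i).image c) r hr4 hr7 (by
    intro i
    have h1 := Finset.card_sdiff_add_card_inter (L (e i)) ((T i).image c)
    rw [hL _ (heE i)] at h1
    have h2 : L (e i) ∩ (T i).image c ⊆
        (T i \ Finset.univ.image f).image c ∪ (Finset.univ.image x ∩ L (e i)) := by
      intro z hz
      rw [Finset.mem_inter, Finset.mem_image] at hz
      obtain ⟨hz, b, hb, rfl⟩ := hz
      rw [Finset.mem_union]
      by_cases hbf : b ∈ Finset.univ.image f
      · right
        simp only [Finset.mem_image, Finset.mem_univ, true_and] at hbf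
        obtain ⟨j, rfl⟩ := hbf
        rw [hc3] at hz ⊢
        exact Finset.mem_inter.2 ⟨Finset.mem_image_of_mem _ (Finset.mem_univ j), hz⟩
      · left
        exact Finset.mem_image_of_mem _ (Finset.mem_sdiff.2 ⟨hb, hbf⟩)
    have h3 := (Finset.card_le_card h2).trans (Finset.card_union_le _ _)
    have h4 : ((T i \ Finset.univ.image f).image c).card ≤ 17 := by
      refine Finset.card_image_le.trans ?_
      rw [Finset.card_sdiff_of_subset (hfT i), Finset.card_image_of_injective _ hfinj]
      have := hT21 i
      simp
      omega
    change 5 ≤ (L (e i) \ (T i).image c).card + (Finset.univ.image x ∩ L (e i)).card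
    omega)
  have hE : ∀ a ∈ G.edgeSet, v ∈ a → ∃ i, e i = a := by
    intro a ha hva
    obtain ⟨z, rfl⟩ := hva
    obtain ⟨i, rfl⟩ := husurj z ha
    exact ⟨i, rfl⟩
  have hce : ∀ i, Function.extend e y c (e i) = y i := fun i => heinj.extend_apply _ _ _
  have hcn : ∀ a, v ∉ a → Function.extend e y c a = c a := by
    intro a ha
    refine Function.extend_apply' _ _ _ ?_
    rintro ⟨i, rfl⟩
    exact ha (hve i)
  have hmix : ∀ i, ∀ b ∈ G.edgeSet, v ∉ b → EdgeClose G (e i) b → y i ≠ c b := by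
    intro i b hb hvb hcl h
    have := hy i
    rw [Finset.mem_sdiff] at this
    exact this.2 (Finset.mem_image.2 ⟨b, (hT i b).2 ⟨hb, hvb, hcl⟩, h.symm⟩)
  refine ⟨Function.extend e y c, ?_, ?_⟩
  · intro a ha har b hb hbr hab hcl
    by_cases hva : v ∈ a
    · obtain ⟨i, rfl⟩ := hE a ha hva
      by_cases hvb : v ∈ b
      · obtain ⟨j, rfl⟩ := hE b hb hvb
        rw [hce, hce]
        exact fun h => hab (by rw [hyinj h])
      · rw [hce, hcn b hvb]
        exact hmix i b hb hvb hcl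
    · by_cases hvb : v ∈ b
      · obtain ⟨j, rfl⟩ := hE b hb hvb
        rw [hce, hcn a hva]
        exact (hmix j a ha hva (aux_close_symm G _ _ hcl)).symm
      · rw [hcn a hva, hcn b hvb]
        exact hc1 a ha hva har b hb hvb hbr hab hcl
  · intro a ha har
    by_cases hva : v ∈ a
    · obtain ⟨i, rfl⟩ := hE a ha hva
      rw [hce]
      exact (Finset.mem_sdiff.1 (hy i)).1
    · rw [hcn a hva]; exact hc2 a ha hva har

/-- In a 4-regular simple graph with girth at least 6, given a vertex v with
incident edges e i, and for each i an edge f i adjacent to e i but not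
incident with v, precolored with a color x i from its list, the precoloring
extends to a strong edge-coloring of G - v from lists of size at least 22. -/
theorem precolored_deleteVertex_strongly_colorable
    {V : Type*} [Fintype V] (G : SimpleGraph V) [DecidableRel G.Adj]
    (hreg : ∀ u, G.degree u = 4) (hgirth : 6 ≤ G.girth)
    (v : V) (e : Fin 4 → Sym2 V)
    (he : ∀ i, e i ∈ G.edgeSet) (hv : ∀ i, v ∈ e i)
    (hinj : Function.Injective e)
    (L : Sym2 V → Finset ℕ) (hL : ∀ ε ∈ G.edgeSet, 22 ≤ (L ε).card)
    (f : Fin 4 → Sym2 V)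
    (hf : ∀ i, f i ∈ G.edgeSet ∧ f i ≠ e i ∧ (∃ u, u ∈ f i ∧ u ∈ e i) ∧ v ∉ f i)
    (x : Fin 4 → ℕ) (hx : ∀ i, x i ∈ L (f i)) :
    ∃ c : Sym2 V → ℕ,
      IsStrongEdgeColoringOn (G.deleteEdges (G.incidenceSet v)) c ∧
      (∀ ε ∈ (G.deleteEdges (G.incidenceSet v)).edgeSet, c ε ∈ L ε) ∧
      ∀ i, c (f i) = x i := by

  classical
  have hne : ∀ i, ∃ u, e i = s(v, u) ∧ G.Adj v u := by
    intro i
    obtain ⟨u, hu⟩ := hv i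
    refine ⟨u, hu, ?_⟩
    have := he i
    rwa [hu] at this
  choose u heu hvu using hne
  have hfw : ∀ i, ∃ w, f i = s(u i, w) ∧ G.Adj (u i) w ∧ w ≠ v := by
    intro i
    obtain ⟨h1, h2, ⟨z, hz1, hz2⟩, h4⟩ := hf i
    rw [heu, Sym2.mem_iff] at hz2
    rcases hz2 with rfl | rfl
    · exact absurd hz1 h4
    · obtain ⟨w, hw⟩ := hz1
      refine ⟨w, hw, ?_, ?_⟩
      · rwa [hw] at h1
      · rintro rfl
        exact h4 (by rw [hw]; simp)
  choose w hfw huw hwv using hfw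
  have huinj : Function.Injective u := fun i j h => hinj (by rw [heu, heu, h])
  have hfn : ∀ i j, i ≠ j → ¬ EdgeClose G (f i) (f j) := fun i j hij => by
    rw [hfw i, hfw j]
    exact aux_nonclose G hgirth (hvu i) (hvu j) (fun h => hij (huinj h)) (huw i) (huw j)
      (hwv i) (hwv j)
  have hfr : ∀ i, ∃ z ∈ f i, G.Reachable v z :=
    fun i => ⟨u i, by rw [hfw]; simp, (hvu i).reachable⟩
  obtain ⟨c₀, hc1, hc2, hc3⟩ := aux_comp G hreg v L hL f
    (fun i => ⟨(hf i).1, (hf i).2.2.2, hfr i⟩) hfn x hx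
  have hL' : ∀ ε, ∃ M : Finset ℕ, M ⊆ L ε ∧ (ε ∈ G.edgeSet → M.card = 22) := by
    intro ε
    by_cases h : ε ∈ G.edgeSet
    · obtain ⟨M, hM, hM'⟩ := Finset.exists_subset_card_eq (hL ε h)
      exact ⟨M, hM, fun _ => hM'⟩
    · exact ⟨∅, by simp, fun h' => absurd h' h⟩
  choose L' hLs hLc using hL'
  have hfull := fun r => aux_full G hreg hgirth r L' hLc
  choose d hd1 hd2 using hfull
  let rep : Sym2 V → V := fun ε => (G.connectedComponentMk (Quot.out ε).1).out
  have hout : ∀ ε : Sym2 V, (Quot.out ε).1 ∈ ε := fun ε => Sym2.out_fst_mem ε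
  have hrep : ∀ ε : Sym2 V, G.Reachable (rep ε) (Quot.out ε).1 := by
    intro ε
    have : G.connectedComponentMk (rep ε) = G.connectedComponentMk (Quot.out ε).1 := Quot.out_eq _
    exact SimpleGraph.ConnectedComponent.exact this
  have hrepE : ∀ a ∈ G.edgeSet, ∀ b ∈ G.edgeSet, EdgeClose G a b → rep a = rep b := by
    intro a ha b hb h
    have : G.connectedComponentMk (Quot.out a).1 = G.connectedComponentMk (Quot.out b).1 :=
      SimpleGraph.ConnectedComponent.sound (aux_close_reach G ha hb h (hout a) (hout b))
    simp only [rep, this]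
  have hmem : ∀ a, a ∈ (G.deleteEdges (G.incidenceSet v)).edgeSet → a ∈ G.edgeSet ∧ v ∉ a := by
    intro a ha
    rw [SimpleGraph.edgeSet_deleteEdges] at ha
    exact ⟨ha.1, fun h => ha.2 ⟨ha.1, h⟩⟩
  refine ⟨fun ε => if ∃ z ∈ ε, G.Reachable v z then c₀ ε else d (rep ε) ε, ?_, ?_, ?_⟩
  · intro a ha b hb hab hcl
    obtain ⟨ha, hva⟩ := hmem a ha
    obtain ⟨hb, hvb⟩ := hmem b hb
    have hcl : EdgeClose G a b := by
      obtain ⟨p, q, hp, hq, h⟩ := hcl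
      refine ⟨p, q, hp, hq, h.imp id (fun h => ?_)⟩
      rw [SimpleGraph.deleteEdges_adj] at h
      exact h.1
    dsimp only
    by_cases har : ∃ z ∈ a, G.Reachable v z
    · have hbr : ∃ z ∈ b, G.Reachable v z := by
        obtain ⟨z, hz, h⟩ := har
        exact ⟨_, hout b, h.trans (aux_close_reach G ha hb hcl hz (hout b))⟩
      rw [if_pos har, if_pos hbr]
      exact hc1 a ha hva har b hb hvb hbr hab hcl
    · have hbr : ¬ ∃ z ∈ b, G.Reachable v z := by
        rintro ⟨z, hz, h⟩
        exact har ⟨_, hout a, h.trans (aux_close_reach G ha hb hcl (hout a) hz).symm⟩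
      rw [if_neg har, if_neg hbr, ← hrepE a ha b hb hcl]
      refine hd1 (rep a) a ha ⟨_, hout a, hrep a⟩ b hb ⟨_, hout b, ?_⟩ hab hcl
      rw [hrepE a ha b hb hcl]
      exact hrep b
  · intro a ha
    obtain ⟨ha, hva⟩ := hmem a ha
    dsimp only
    split_ifs with har
    · exact hc2 a ha hva har
    · exact hLs a (hd2 (rep a) a ha ⟨_, hout a, hrep a⟩)
  · intro i
    dsimp only
    rw [if_pos (hfr i)]
    exact hc3 i
end
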